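/- Fix θ = (σ,δ,α) with σ > 0, δ > 0, α ∈ (0,2). There exist C > 0 and N ∈ ℕ such that for all n ≥ N, all Γ ≥ 1 and all y with |y| > Γ: | l_α(y, w_n(θ)) + c_α w_n(θ)^α ψ_α^{(1)}(y) − (c_α/2) ln(ln n) w_n(θ)^α ψ_α^{(0)}(y) − w_n(θ)^α [c_α ln(δ/σ) + ∂_α c_α] ψ_α^{(0)}(y) | ≤ C w_n(θ)^α ( ψ_α^{(0)}(y) + ψ_α^{(1)}(y)/ln(ln n) ) ( ln(ln n)/√Γ + ln(n) φ(Γ/3) + ln(n)/n^{1−α/2} ). -/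

import Mathlib

open MeasureTheory Filter Set Topology Matrix

noncomputable section

namespace LevyLAN

/-- Standard Gaussian density `φ`. -/
def gauss (y : ℝ) : ℝ := (Real.sqrt (2 * Real.pi))⁻¹ * Real.exp (-(y ^ 2) / 2)

/-- Symmetric `α`-stable density `φ_α`, defined by Fourier inversion. -/
def stableDensity (α z : ℝ) : ℝ :=
  (2 * Real.pi)⁻¹ * ∫ u : ℝ, Real.cos (z * u) * Real.exp (-(|u| ^ α))

/-- `∂_α φ_α`. -/
def stableDensityDalpha (α z : ℝ) : ℝ :=
  -(2 * Real.pi)⁻¹ * ∫ u : ℝ, Real.cos (z * u) * |u| ^ α * Real.log |u| * Real.exp (-(|u| ^ α))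

/-- The operator `(D f) y = (y * f y)' = f y + y * f' y`. -/
def Dop (f : ℝ → ℝ) (y : ℝ) : ℝ := f y + y * deriv f y

/-- `f_α(y, w)`. -/
def fFun (α y w : ℝ) : ℝ := ∫ z : ℝ, gauss (y - w * z) * stableDensity α z

/-- `g_α(y, w)`. -/
def gFun (α y w : ℝ) : ℝ := ∫ z : ℝ, Dop gauss (y - w * z) * stableDensity α z

/-- `h_α(y, w)`. -/
def hFun (α y w : ℝ) : ℝ := ∫ z : ℝ, gauss (y - w * z) * Dop (stableDensity α) z

/-- `k_α(y, w)`. -/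
def kFun (α y w : ℝ) : ℝ := ∫ z : ℝ, gauss (y - w * z) * stableDensityDalpha α z

/-- `c_α`. -/
def cAlpha (α : ℝ) : ℝ :=
  if α = 1 then 1 / Real.pi
  else -(α * (α - 1)) / (2 * Real.Gamma (2 - α) * Real.cos (Real.pi * α / 2))

/-- `w_n(θ) = n^{1/2 - 1/α} δ / σ`. -/
def wn (n : ℕ) (σ δ α : ℝ) : ℝ := (n : ℝ) ^ ((1 : ℝ) / 2 - 1 / α) * δ / σ

/-- `l_α(y, w)` (it depends on `n`). -/
def lFun (n : ℕ) (α y w : ℝ) : ℝ :=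
  ((Real.log n - Real.log (Real.log n)) / (2 * α) - Real.log n / α ^ 2) * hFun α y w
    + kFun α y w

def kappa0 (σ δ α : ℝ) : ℝ := 2 * cAlpha α / (α * (2 - α) ^ (α / 2)) * (δ / σ) ^ α

def kappa1 (σ δ α : ℝ) : ℝ :=
  Real.log (δ / σ) + deriv cAlpha α / cAlpha α - Real.log (2 - α) / 2 - 1 / α

/-- The density `p_{1/n}(y, θ)`, with parameter `θ = (σ, δ, α) : Fin 3 → ℝ`. -/
def pdens (n : ℕ) (θ : Fin 3 → ℝ) (y : ℝ) : ℝ :=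
  Real.sqrt n / θ 0 * fFun (θ 2) (Real.sqrt n * y / θ 0) (wn n (θ 0) (θ 1) (θ 2))

/-- The log-likelihood `ln L_n(θ)`. -/
def logLik (n : ℕ) (θ : Fin 3 → ℝ) (x : Fin n → ℝ) : ℝ :=
  ∑ i, Real.log (pdens n θ (x i))

/-- Partial derivative in the `j`-th parameter coordinate. -/
def pderiv (j : Fin 3) (F : (Fin 3 → ℝ) → ℝ) (θ : Fin 3 → ℝ) : ℝ :=
  deriv (fun t => F (Function.update θ j t)) (θ j)

/-- The score `G_n(θ) = ∇_θ ln L_n(θ)`. -/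
def scoreVec (n : ℕ) (θ : Fin 3 → ℝ) (x : Fin n → ℝ) : Fin 3 → ℝ :=
  fun j => pderiv j (fun θ' => logLik n θ' x) θ

/-- The Hessian matrix `J_n(θ)` of the log-likelihood. -/
def hessMat (n : ℕ) (θ : Fin 3 → ℝ) (x : Fin n → ℝ) : Matrix (Fin 3) (Fin 3) ℝ :=
  Matrix.of fun i j => pderiv i (fun θ' => pderiv j (fun θ'' => logLik n θ'' x) θ') θ

def rate (n : ℕ) (α : ℝ) : ℝ := Real.log n ^ (α / 4) / (n : ℝ) ^ (α / 4)

/-- The rate matrix `u_n(θ)`. -/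
def un (n : ℕ) (θ : Fin 3 → ℝ) : Matrix (Fin 3) (Fin 3) ℝ :=
  !![1 / Real.sqrt n, 0, 0;
     0, rate n (θ 2), -(rate n (θ 2) * (θ 1 / (2 * θ 2)) * (Real.log n - Real.log (Real.log n)));
     0, 0, rate n (θ 2)]

/-- The information matrix `I(θ)`. -/
def Imat (θ : Fin 3 → ℝ) : Matrix (Fin 3) (Fin 3) ℝ :=
  !![2 / θ 0 ^ 2, 0, 0;
     0, θ 2 ^ 2 / θ 1 ^ 2 * kappa0 (θ 0) (θ 1) (θ 2),
        θ 2 / θ 1 * kappa0 (θ 0) (θ 1) (θ 2) * kappa1 (θ 0) (θ 1) (θ 2);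
     0, θ 2 / θ 1 * kappa0 (θ 0) (θ 1) (θ 2) * kappa1 (θ 0) (θ 1) (θ 2),
        kappa0 (θ 0) (θ 1) (θ 2) * (kappa1 (θ 0) (θ 1) (θ 2) ^ 2 + 1 / θ 2 ^ 2)]

/-- `ℙ_n`, the `n`-fold product of the law with Lebesgue density `p_{1/n}(·, θ)`. -/
def Pn (n : ℕ) (θ : Fin 3 → ℝ) : Measure (Fin n → ℝ) :=
  Measure.pi fun _ => MeasureTheory.volume.withDensity fun y => ENNReal.ofReal (pdens n θ y)

/-- The standard Gaussian measure on `ℝ³`. -/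
def stdGauss3 : Measure (Fin 3 → ℝ) :=
  Measure.pi fun _ => ProbabilityTheory.gaussianReal 0 1

/-- Euclidean (Frobenius) norm of a real 3×3 matrix. -/
def frobNorm (M : Matrix (Fin 3) (Fin 3) ℝ) : ℝ := Real.sqrt (∑ i, ∑ j, M i j ^ 2)

/-- Euclidean norm of a vector of `ℝ³`. -/
def vecNorm (v : Fin 3 → ℝ) : ℝ := Real.sqrt (∑ j, v j ^ 2)

/-- The admissible families of functions `ψ_α^{(p)}`. -/
structure IsPsiFamily (ψ : ℝ → ℕ → ℝ → ℝ) : Prop where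
  contDiff : ∀ α ∈ Set.Ioo (0 : ℝ) 2, ∀ p : ℕ, ContDiff ℝ 2 (ψ α p)
  pos : ∀ α ∈ Set.Ioo (0 : ℝ) 2, ∀ p : ℕ, ∀ y : ℝ, 0 < ψ α p y
  even : ∀ α ∈ Set.Ioo (0 : ℝ) 2, ∀ p : ℕ, ∀ y : ℝ, ψ α p (-y) = ψ α p y
  eq_one : ∀ α ∈ Set.Ioo (0 : ℝ) 2, ∀ p : ℕ, ∀ y : ℝ, |y| ≤ 1 → ψ α p y = 1
  eq_tail : ∀ α ∈ Set.Ioo (0 : ℝ) 2, ∀ p : ℕ, ∀ y : ℝ, 3 ≤ |y| →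
    ψ α p y = Real.log |y| ^ p / |y| ^ (α + 1)
  unifBound : ∀ K : Set ℝ, K ⊆ Set.Ioo (0 : ℝ) 2 → IsCompact K → ∀ p : ℕ,
    ∃ c > (0 : ℝ), ∃ C : ℝ, ∀ α ∈ K, ∀ y : ℝ, 1 ≤ |y| → |y| ≤ 3 →
      c ≤ ψ α p y ∧ ψ α p y ≤ C

/-- `𝓘_α^{(k,l)}`. -/
def Ical (ψ : ℝ → ℕ → ℝ → ℝ) (α : ℝ) (k l : ℕ) (y : ℝ) : ℝ :=
  ∫ z in {z : ℝ | 1 < |z|}, Dop^[k] gauss (y - z) * ψ α l z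

/-- `f_α^{(k,l,m)}`. -/
def fklm (α : ℝ) (k l m : ℕ) (y w : ℝ) : ℝ :=
  ∫ z : ℝ, Dop^[k] gauss (y - w * z)
    * Dop^[l] (fun z' => iteratedDeriv m (fun a => stableDensity a z') α) z

def Gamman (n : ℕ) (α : ℝ) : ℝ := Real.sqrt ((1 - α / 2) * Real.log n)

def Mn (n : ℕ) (α : ℝ) : ℝ := Real.sqrt ((2 - α) * Real.log n)

def Kconst (σ δ α : ℝ) : ℝ := deriv cAlpha α + cAlpha α * Real.log (δ / σ)

/-- decay bound -/
lemma decay_aux {α : ℝ} (hα : α ∈ Set.Ioo (0:ℝ) 2) (x E : ℝ) (hE0 : 0 ≤ E) (hE1 : E ≤ 1)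
    (hE : 0 ≤ x → E ≤ Real.exp (-(Real.exp x / 4))) :
    (3 * (1 + |x|)) * Real.exp ((α + 1) * x) * E ≤ 10000000 * Real.exp (-α * |x|) := by
  obtain ⟨h0, h2⟩ := hα
  have hlin : 1 + |x| ≤ Real.exp |x| := by linarith [Real.add_one_le_exp |x|]
  rcases le_total 0 x with hx | hx
  · have hE := hE hx
    rw [abs_of_nonneg hx] at *
    have key : Real.exp (-(Real.exp x / 4)) ≤ 720 * 4096 * Real.exp (-6 * x) := by
      have hv : 0 < Real.exp x / 4 := by positivity
      have h6 := Real.pow_div_factorial_le_exp (Real.exp x / 4) hv.le 6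
      have e6 : (Real.exp x / 4) ^ 6 = Real.exp (6 * x) / 4096 := by
        rw [div_pow, ← Real.exp_nat_mul]; norm_num
      rw [e6] at h6
      have : (Nat.factorial 6 : ℝ) = 720 := by norm_num [Nat.factorial]
      rw [this] at h6
      rw [Real.exp_neg, show -6 * x = -(6 * x) by ring, Real.exp_neg]
      have hp := Real.exp_pos (6 * x)
      rw [inv_le_comm₀ (Real.exp_pos _) (by positivity)]
      refine le_trans (le_of_eq ?_) h6
      field_simp
    have e : Real.exp (-α * x) = Real.exp (x + (α+1)*x + -6 * x) * Real.exp ((4 - 2 * α) * x) := by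
      rw [← Real.exp_add]; ring_nf
    have e1 : 1 ≤ Real.exp ((4 - 2 * α) * x) := Real.one_le_exp (by nlinarith)
    calc (3 * (1 + x)) * Real.exp ((α + 1) * x) * E
        ≤ (3 * Real.exp x) * Real.exp ((α+1)*x) * (720 * 4096 * Real.exp (-6 * x)) := by
          have := hE.trans key
          gcongr
      _ = 8847360 * Real.exp (x + (α+1)*x + -6 * x) := by
          rw [Real.exp_add, Real.exp_add]; ring
      _ ≤ 10000000 * (Real.exp (x + (α+1)*x + -6 * x) * Real.exp ((4 - 2 * α) * x)) := by
          nlinarith [Real.exp_pos (x + (α+1)*x + -6 * x)]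
      _ = _ := by rw [e]
  · rw [abs_of_nonpos hx] at *
    calc (3 * (1 + -x)) * Real.exp ((α + 1) * x) * E
        ≤ (3 * Real.exp (-x)) * Real.exp ((α+1)*x) * 1 := by gcongr
      _ = 3 * Real.exp (-α * -x) := by
          rw [mul_one, mul_assoc, ← Real.exp_add]; ring_nf
      _ ≤ _ := by nlinarith [Real.exp_pos (-α * -x)]

lemma integrable_abs_of {f : ℝ → ℝ} (hf : IntegrableOn f (Ioi 0)) :
    Integrable (fun x : ℝ => f |x|) := by
  have h1 : IntegrableOn (fun x : ℝ => f |x|) (Ioi 0) :=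
    hf.congr_fun (fun x hx => by simp [abs_of_pos (show 0 < x from hx)]) measurableSet_Ioi
  have h2 : IntegrableOn (fun x : ℝ => f |x|) (Iio 0) := by
    rw [← neg_zero] at h1
    simpa using h1.comp_neg_Iio
  have h3 : IntegrableOn (fun x : ℝ => f |x|) (Iic 0) := by
    rwa [integrableOn_Iic_iff_integrableOn_Iio]
  have := h3.union h1
  rwa [Iic_union_Ioi, integrableOn_univ] at this

lemma integrable_exp_abs {c : ℝ} (hc : 0 < c) : Integrable (fun x : ℝ => Real.exp (-c * |x|)) := by
  refine integrable_abs_of (f := fun x => Real.exp (-c * x)) ?_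
  exact integrableOn_exp_mul_Ioi (by linarith) 0

lemma contour (G : ℂ → ℂ) (hG : Differentiable ℂ G) (a b C c : ℝ) (hab : a ≤ b) (hc : 0 < c)
    (hb : ∀ x θ : ℝ, a ≤ θ → θ ≤ b → ‖G (x + θ * Complex.I)‖ ≤ C * Real.exp (-c * |x|)) :
    (∀ θ : ℝ, a ≤ θ → θ ≤ b → Integrable (fun x : ℝ => G (x + θ * Complex.I))) ∧
    ∫ x : ℝ, G (x + a * Complex.I) = ∫ x : ℝ, G (x + b * Complex.I) := by
  have hIntg : ∀ θ : ℝ, a ≤ θ → θ ≤ b → Integrable (fun x : ℝ => G (x + θ * Complex.I)) := by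
    intro θ h1 h2
    refine Integrable.mono' ((integrable_exp_abs hc).const_mul C) ?_ ?_
    · have : Continuous G := hG.continuous
      exact (by fun_prop : Continuous fun x : ℝ => G (x + θ * Complex.I)).aestronglyMeasurable
    · exact Filter.Eventually.of_forall fun x => hb x θ h1 h2
  refine ⟨hIntg, ?_⟩
  have hA := intervalIntegral_tendsto_integral (hIntg a le_rfl hab) tendsto_neg_atTop_atBot tendsto_id
  have hB := intervalIntegral_tendsto_integral (hIntg b hab le_rfl) tendsto_neg_atTop_atBot tendsto_id
  have hz : Tendsto (fun R : ℝ => C * Real.exp (-c * |R|) * |b - a|) atTop (𝓝 0) := by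
    have : Tendsto (fun R : ℝ => Real.exp (-c * |R|)) atTop (𝓝 0) := by
      apply Real.tendsto_exp_atBot.comp
      exact (tendsto_abs_atTop_atTop).const_mul_atTop_of_neg (by linarith)
    simpa using (this.const_mul C).mul_const |b - a|
  have side : ∀ s : ℝ, ‖∫ θ : ℝ in a..b, G (s + θ * Complex.I)‖ ≤ C * Real.exp (-c * |s|) * |b - a| := by
    intro s
    apply intervalIntegral.norm_integral_le_of_norm_le_const
    intro θ hθ
    rw [uIoc_of_le hab] at hθ
    exact hb s θ hθ.1.le hθ.2
  have hS1 : Tendsto (fun R : ℝ => ∫ θ : ℝ in a..b, G (((R : ℝ) : ℂ) + θ * Complex.I)) atTop (𝓝 0) :=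
    squeeze_zero_norm (fun R => side R) hz
  have hS2 : Tendsto (fun R : ℝ => ∫ θ : ℝ in a..b, G (((-R : ℝ) : ℂ) + θ * Complex.I)) atTop (𝓝 0) :=
    squeeze_zero_norm (fun R => by simpa using side (-R)) hz
  have hlim := ((hA.sub hB).add (hS1.const_smul Complex.I)).sub (hS2.const_smul Complex.I)
  have h0 : ∀ R : ℝ, (∫ x : ℝ in -R..R, G (x + a * Complex.I)) - (∫ x : ℝ in -R..R, G (x + b * Complex.I)) +
      Complex.I • (∫ θ : ℝ in a..b, G (((R : ℝ) : ℂ) + θ * Complex.I)) -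
      Complex.I • (∫ θ : ℝ in a..b, G (((-R : ℝ) : ℂ) + θ * Complex.I)) = 0 := by
    intro R
    have := Complex.integral_boundary_rect_eq_zero_of_differentiableOn G (⟨-R, a⟩) (⟨R, b⟩)
      hG.differentiableOn
    simpa using this
  have hlim2 := hlim.congr h0
  have := tendsto_nhds_unique hlim2 tendsto_const_nhds
  simp only [smul_zero, add_zero, sub_zero] at this
  exact sub_eq_zero.mp this

lemma int_exp_sub (F : ℝ → ℂ) : ∫ x, F x = ∫ t in Ioi (0:ℝ), ((t⁻¹ : ℝ) : ℂ) * F (Real.log t) := by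
  have := integral_image_eq_integral_abs_deriv_smul (s := univ) (f := Real.exp) (f' := Real.exp)
    MeasurableSet.univ (fun x _ => (Real.hasDerivAt_exp x).hasDerivWithinAt)
    Real.exp_injective.injOn (fun t => ((t⁻¹ : ℝ) : ℂ) * F (Real.log t))
  rw [image_univ, Real.range_exp] at this
  rw [this, setIntegral_univ]
  congr 1; ext x
  rw [abs_of_pos (Real.exp_pos x), Real.log_exp, Complex.real_smul, ← mul_assoc,
    ← Complex.ofReal_mul, mul_inv_cancel₀ (Real.exp_pos x).ne']
  simp

lemma int_exp_integrable (F : ℝ → ℂ) (hF : Integrable F) :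
    IntegrableOn (fun t => ((t⁻¹ : ℝ) : ℂ) * F (Real.log t)) (Ioi (0:ℝ)) := by
  have := integrableOn_image_iff_integrableOn_abs_deriv_smul (s := univ) (f := Real.exp) (f' := Real.exp)
    MeasurableSet.univ (fun x _ => (Real.hasDerivAt_exp x).hasDerivWithinAt)
    Real.exp_injective.injOn (fun t => ((t⁻¹ : ℝ) : ℂ) * F (Real.log t))
  rw [image_univ, Real.range_exp] at this
  rw [this, integrableOn_univ]
  refine hF.congr (Filter.Eventually.of_forall fun x => ?_)
  simp only
  rw [abs_of_pos (Real.exp_pos x), Real.log_exp, Complex.real_smul, ← mul_assoc,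
    ← Complex.ofReal_mul, mul_inv_cancel₀ (Real.exp_pos x).ne']
  simp

/-- contour integrand -/
def Gf (α : ℝ) (j : ℕ) (q : ℂ → ℂ) (ζ : ℂ) : ℂ :=
  ζ ^ j * Complex.exp ((α + 1) * ζ) * Complex.exp (q ζ)

def q0 (y : ℝ) (ζ : ℂ) : ℂ := Complex.I * y * Complex.exp ζ

def q1 (α y ε : ℝ) (ζ : ℂ) : ℂ :=
  q0 y ζ - (Complex.exp (2 * ζ) / 2 + ε * Complex.exp (α * ζ))

lemma q0_re (y x θ : ℝ) : (q0 y (x + θ * Complex.I)).re = -(y * Real.exp x * Real.sin θ) := by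
  simp [q0, Complex.exp_re, Complex.exp_im]
  ring

lemma qd_re (α ε x θ : ℝ) : (Complex.exp (2 * (x + θ * Complex.I)) / 2
      + ε * Complex.exp (α * (x + θ * Complex.I))).re =
    Real.exp (2 * x) * Real.cos (2 * θ) / 2 + ε * (Real.exp (α * x) * Real.cos (α * θ)) := by
  have h1 : (2 : ℂ) * (x + θ * Complex.I) = ((2 * x : ℝ) : ℂ) + ((2 * θ : ℝ) : ℂ) * Complex.I := by
    push_cast; ring
  have h2 : (α : ℂ) * (x + θ * Complex.I) = ((α * x : ℝ) : ℂ) + ((α * θ : ℝ) : ℂ) * Complex.I := by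
    push_cast; ring
  have h3 : ∀ z : ℂ, (z / 2).re = z.re / 2 := fun z => by simp
  rw [h1, h2, Complex.add_re, h3, Complex.re_ofReal_mul, Complex.exp_re, Complex.exp_re]
  simp only [Complex.add_re, Complex.add_im, Complex.ofReal_re, Complex.ofReal_im, Complex.re_ofReal_mul,
    Complex.im_ofReal_mul, Complex.I_re, Complex.I_im]
  simp

lemma q1_re (α y ε x θ : ℝ) : (q1 α y ε (x + θ * Complex.I)).re =
    -(y * Real.exp x * Real.sin θ) - (Real.exp (2 * x) * Real.cos (2 * θ) / 2
      + ε * (Real.exp (α * x) * Real.cos (α * θ))) := by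
  rw [q1, Complex.sub_re, q0_re, qd_re]

lemma Gf_bound {α : ℝ} (hα : α ∈ Set.Ioo (0:ℝ) 2) {j : ℕ} (hj : j ≤ 1) (q : ℂ → ℂ) (x θ : ℝ)
    (h1 : |θ| ≤ 2) (hq : (q (x + θ * Complex.I)).re ≤ 0)
    (hq2 : 0 ≤ x → (q (x + θ * Complex.I)).re ≤ -(Real.exp x / 4)) :
    ‖Gf α j q (x + θ * Complex.I)‖ ≤ 10000000 * Real.exp (-α * |x|) := by
  refine le_trans ?_ (decay_aux hα x (Real.exp (q (x + θ * Complex.I)).re) (Real.exp_pos _).le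
    (Real.exp_le_one_iff.mpr hq) (fun h => Real.exp_le_exp.mpr (hq2 h)))
  rw [Gf, norm_mul, norm_mul, Complex.norm_exp, Complex.norm_exp]
  have e : ((α + 1 : ℂ) * (x + θ * Complex.I)).re = (α + 1) * x := by simp
  rw [e]
  gcongr
  have h3 : ‖(x + θ * Complex.I : ℂ)‖ ≤ |x| + |θ| := by
    refine (norm_add_le _ _).trans ?_
    simp
  have := abs_nonneg x
  interval_cases j
  · simp; linarith
  · rw [pow_one]; linarith

lemma Gf_diff {α : ℝ} {j : ℕ} {q : ℂ → ℂ} (hq : Differentiable ℂ q) : Differentiable ℂ (Gf α j q) := by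
  unfold Gf; fun_prop

lemma q0_diff (y : ℝ) : Differentiable ℂ (q0 y) := by unfold q0; fun_prop
lemma q1_diff (α y ε : ℝ) : Differentiable ℂ (q1 α y ε) := by
  have := q0_diff y
  unfold q1; fun_prop

lemma cos_ge_half {t : ℝ} (h0 : 0 ≤ t) (h1 : t ≤ Real.pi / 3) : 1 / 2 ≤ Real.cos t := by
  rw [← Real.cos_pi_div_three]
  apply Real.cos_le_cos_of_nonneg_of_le_pi h0 _ h1
  linarith [Real.pi_pos]

lemma shift1 {α : ℝ} (hα : α ∈ Set.Ioo (0:ℝ) 2) {j : ℕ} (hj : j ≤ 1) (y ε : ℝ) (hy : 1 ≤ y) (hε : 0 ≤ ε) :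
    (∀ θ : ℝ, 0 ≤ θ → θ ≤ Real.pi / 6 → Integrable (fun x : ℝ => Gf α j (q1 α y ε) (x + θ * Complex.I))) ∧
    ∫ x : ℝ, Gf α j (q1 α y ε) (x + (0:ℝ) * Complex.I)
      = ∫ x : ℝ, Gf α j (q1 α y ε) (x + (Real.pi / 6 : ℝ) * Complex.I) := by
  have hpi := Real.pi_pos
  refine contour _ (Gf_diff (q1_diff _ _ _)) 0 (Real.pi/6) 10000000 α (by positivity) hα.1 ?_
  intro x θ h0 h1
  have hc : Real.exp (2 * x) / 4 ≤ Real.exp (2 * x) * Real.cos (2 * θ) / 2 := by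
    have := cos_ge_half (t := 2 * θ) (by linarith) (by linarith)
    nlinarith [Real.exp_pos (2 * x)]
  have hc2 : 0 ≤ ε * (Real.exp (α * x) * Real.cos (α * θ)) := by
    have := cos_ge_half (t := α * θ) (mul_nonneg hα.1.le h0) (by nlinarith [hα.1, hα.2])
    have := Real.exp_pos (α * x)
    have : 0 ≤ Real.cos (α * θ) := by linarith
    positivity
  have hs : 0 ≤ y * Real.exp x * Real.sin θ := by
    have := Real.sin_nonneg_of_nonneg_of_le_pi h0 (by linarith)
    positivity
  have hp := Real.exp_pos (2 * x)
  apply Gf_bound hα hj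
  · rw [abs_le]; constructor <;> linarith [Real.pi_le_four]
  · rw [q1_re]; linarith
  · intro hx
    rw [q1_re]
    have : Real.exp x ≤ Real.exp (2 * x) := Real.exp_le_exp.mpr (by linarith)
    linarith

lemma shift0 {α : ℝ} (hα : α ∈ Set.Ioo (0:ℝ) 2) {j : ℕ} (hj : j ≤ 1) (y : ℝ) (hy : 1 ≤ y) :
    (∀ θ : ℝ, Real.pi / 6 ≤ θ → θ ≤ Real.pi / 2 → Integrable (fun x : ℝ => Gf α j (q0 y) (x + θ * Complex.I))) ∧
    ∫ x : ℝ, Gf α j (q0 y) (x + (Real.pi / 6 : ℝ) * Complex.I)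
      = ∫ x : ℝ, Gf α j (q0 y) (x + (Real.pi / 2 : ℝ) * Complex.I) := by
  have hpi := Real.pi_pos
  refine contour _ (Gf_diff (q0_diff _)) (Real.pi/6) (Real.pi/2) 10000000 α (by linarith) hα.1 ?_
  intro x θ h0 h1
  have hs : 1 / 2 ≤ Real.sin θ := by
    rw [← Real.sin_pi_div_six]
    apply Real.sin_le_sin_of_le_of_le_pi_div_two <;> linarith
  have hp := Real.exp_pos x
  have h4 : Real.exp x / 4 ≤ y * Real.exp x * Real.sin θ := by
    have : Real.exp x ≤ y * Real.exp x := by nlinarith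
    nlinarith
  apply Gf_bound hα hj
  · rw [abs_le]; constructor <;> linarith [Real.pi_le_four]
  · rw [q0_re]; linarith
  · intro hx
    rw [q0_re]; linarith

lemma norm_exp_neg_sub_one {z : ℂ} (hz : 0 ≤ z.re) : ‖Complex.exp (-z) - 1‖ ≤ 2 * ‖z‖ := by
  rcases le_total ‖z‖ 1 with h | h
  · simpa using Complex.norm_exp_sub_one_le (x := -z) (by simpa using h)
  · have : ‖Complex.exp (-z)‖ ≤ 1 := by
      rw [Complex.norm_exp, Real.exp_le_one_iff]; simpa using hz
    calc _ ≤ ‖Complex.exp (-z)‖ + ‖(1:ℂ)‖ := norm_sub_le _ _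
      _ ≤ 1 + 1 := by gcongr; simp
      _ ≤ _ := by linarith

lemma abs_log_le {t : ℝ} (ht : 0 < t) : 1 + |Real.log t| ≤ 2 * (t + t⁻¹) := by
  have h1 := Real.log_le_sub_one_of_pos ht
  have h2 := Real.log_le_sub_one_of_pos (inv_pos.mpr ht)
  rw [Real.log_inv] at h2
  have := inv_pos.mpr ht
  have h3 : |Real.log t| ≤ t + t⁻¹ := by rw [abs_le]; constructor <;> linarith
  have h4 : 1 ≤ t + t⁻¹ := by
    have : t * t⁻¹ = 1 := mul_inv_cancel₀ ht.ne'
    nlinarith [sq_nonneg (t - t⁻¹)]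
  linarith

lemma abs_log_le' {α t : ℝ} (hα : 0 < α) (ht : 0 < t) :
    1 + |Real.log t| ≤ (2 + 2 / α) * (t ^ α + t ^ (-α)) := by
  have h := abs_log_le (t := t ^ α) (by positivity)
  rw [Real.log_rpow ht, abs_mul, abs_of_pos hα, ← Real.rpow_neg ht.le] at h
  set L := |Real.log t|
  set S := t ^ α + t ^ (-α)
  have hL : 0 ≤ L := abs_nonneg _
  have h1 : 1 ≤ 2 * S := by nlinarith
  have h2 : L ≤ 2 / α * S := by
    rw [div_mul_eq_mul_div, le_div_iff₀ hα]; linarith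
  nlinarith

/-- pointwise bound of the difference -/
lemma diff_pt {α : ℝ} (hα : α ∈ Set.Ioo (0:ℝ) 2) {j : ℕ} (hj : j ≤ 1) (y ε t : ℝ) (hε : 0 ≤ ε)
    (ht : 0 < t) :
    ‖((t⁻¹ : ℝ) : ℂ) * (Gf α j (q1 α y ε) (Real.log t + (Real.pi / 6 : ℝ) * Complex.I)
      - Gf α j (q0 y) (Real.log t + (Real.pi / 6 : ℝ) * Complex.I))‖ ≤
    (8 + 8 / α) * ((t ^ (α + 3) + t ^ (α + 1)) + ε * (t ^ (3 * α) + t ^ α)) * Real.exp (-(y / 2 * t)) := by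
  obtain ⟨hα0, hα2⟩ := hα
  have hpi := Real.pi_pos
  set θ := Real.pi / 6 with hθ
  set ζ : ℂ := Real.log t + (θ : ℝ) * Complex.I with hζ
  have hlog : Real.exp (Real.log t) = t := Real.exp_log ht
  have hpow : ∀ a : ℝ, Real.exp (a * Real.log t) = t ^ a := fun a => by
    rw [Real.rpow_def_of_pos ht, mul_comm]
  set d : ℂ := Complex.exp (2 * ζ) / 2 + ε * Complex.exp (α * ζ) with hd
  have hdre : 0 ≤ d.re := by
    rw [hd, hζ, qd_re]
    have h1 := cos_ge_half (t := 2 * θ) (by positivity) (by rw [hθ]; linarith)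
    have h2 := cos_ge_half (t := α * θ) (by positivity) (by rw [hθ]; nlinarith)
    have h1' : 0 ≤ Real.cos (2 * θ) := by linarith
    have h2' : 0 ≤ Real.cos (α * θ) := by linarith
    positivity
  have hdn : ‖d‖ ≤ t ^ (2:ℝ) / 2 + ε * t ^ α := by
    refine (norm_add_le _ _).trans ?_
    rw [norm_div, norm_mul, Complex.norm_exp, Complex.norm_exp, hζ]
    have e1 : ((2:ℂ) * (Real.log t + (θ : ℝ) * Complex.I)).re = 2 * Real.log t := by simp
    have e2 : ((α:ℂ) * (Real.log t + (θ : ℝ) * Complex.I)).re = α * Real.log t := by simp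
    rw [e1, e2, hpow, hpow]
    simp [abs_of_nonneg hε]
  have hfac : Gf α j (q1 α y ε) ζ - Gf α j (q0 y) ζ
      = Gf α j (q0 y) ζ * (Complex.exp (-d) - 1) := by
    simp only [Gf, q1]
    rw [← hd, sub_eq_add_neg (q0 y ζ) d, Complex.exp_add]; ring
  have hq0 : (q0 y ζ).re = -(y / 2 * t) := by
    rw [hζ, q0_re, hlog, hθ, Real.sin_pi_div_six]; ring
  have hζn : ‖ζ ^ j‖ ≤ 1 + |Real.log t| := by
    have h3 : ‖ζ‖ ≤ |Real.log t| + |θ| := by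
      refine (norm_add_le _ _).trans ?_
      simp
    have : |θ| ≤ 1 := by rw [abs_of_pos (by positivity), hθ]; linarith [Real.pi_le_four]
    interval_cases j
    · simp
    · rw [pow_one]; linarith
  have hG : ‖Gf α j (q0 y) ζ‖ ≤ (1 + |Real.log t|) * t ^ (α + 1) * Real.exp (-(y / 2 * t)) := by
    rw [Gf, norm_mul, norm_mul, Complex.norm_exp, Complex.norm_exp, hq0]
    have e : ((α + 1 : ℂ) * ζ).re = (α + 1) * Real.log t := by rw [hζ]; simp
    rw [e, hpow]
    gcongr
  have ha : t⁻¹ * t ^ (α + 1) = t ^ α := by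
    rw [Real.rpow_add_one ht.ne']; field_simp
  rw [hfac, norm_mul, norm_mul, Complex.norm_real, Real.norm_eq_abs, abs_of_pos (inv_pos.mpr ht)]
  have hl1 := abs_log_le ht
  have hl2 := abs_log_le' hα0 ht
  set L := 1 + |Real.log t| with hL
  have hL0 : 0 ≤ L := by positivity
  set X := Real.exp (-(y / 2 * t)) with hX
  have hX0 : 0 < X := Real.exp_pos _
  have b1 : L * t ^ (α + 2) ≤ 2 * (t ^ (α + 3) + t ^ (α + 1)) := by
    calc L * t ^ (α+2) ≤ (2 * (t + t⁻¹)) * t ^ (α+2) := by gcongr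
      _ = _ := by
        rw [show α + 3 = (α + 2) + 1 by ring, Real.rpow_add_one ht.ne' (α+2),
          show α + 2 = (α + 1) + 1 by ring, Real.rpow_add_one ht.ne' (α + 1)]
        field_simp
  have b2 : L * t ^ (2 * α) ≤ (2 + 2 / α) * (t ^ (3 * α) + t ^ α) := by
    calc L * t ^ (2 * α) ≤ ((2 + 2 / α) * (t ^ α + t ^ (-α))) * t ^ (2 * α) := by gcongr
      _ = _ := by
        rw [mul_assoc, add_mul (t ^ α), ← Real.rpow_add ht, ← Real.rpow_add ht]
        ring_nf
  calc t⁻¹ * (‖Gf α j (q0 y) ζ‖ * ‖Complex.exp (-d) - 1‖)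
      ≤ t⁻¹ * ((L * t ^ (α + 1) * X) * (2 * (t ^ (2:ℝ) / 2 + ε * t ^ α))) := by
        gcongr
        exact (norm_exp_neg_sub_one hdre).trans (by gcongr)
    _ = L * X * (t⁻¹ * t ^ (α + 1)) * (t ^ (2:ℝ) + 2 * ε * t ^ α) := by ring
    _ = X * (L * t ^ (α + 2) + 2 * ε * (L * t ^ (2 * α))) := by
        rw [ha, Real.rpow_add ht, two_mul α, Real.rpow_add ht]; ring
    _ ≤ X * (2 * (t ^ (α + 3) + t ^ (α + 1)) + 2 * ε * ((2 + 2 / α) * (t ^ (3 * α) + t ^ α))) := by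
        gcongr
    _ ≤ _ := by
        have hA : 0 ≤ t ^ (α + 3) + t ^ (α + 1) := by positivity
        have hB : 0 ≤ ε * (t ^ (3 * α) + t ^ α) := by positivity
        have hi : 0 ≤ 1 / α := by positivity
        have : 8 / α = 8 * (1 / α) := by ring
        have h2 : 2 / α = 2 * (1 / α) := by ring
        rw [this, h2, mul_comm _ X]
        apply mul_le_mul_of_nonneg_left _ hX0.le
        nlinarith [mul_nonneg hi hA, mul_nonneg hi hB]

lemma gam_int {a b : ℝ} (ha : -1 < a) (hb : 0 < b) :
    IntegrableOn (fun t : ℝ => t ^ a * Real.exp (-(b * t))) (Ioi 0) ∧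
    ∫ t in Ioi (0:ℝ), t ^ a * Real.exp (-(b * t)) = (1 / b) ^ (a + 1) * Real.Gamma (a + 1) := by
  constructor
  · have := integrableOn_rpow_mul_exp_neg_mul_rpow (s := a) ha (p := 1) one_pos hb
    simpa using this
  · have := Real.integral_rpow_mul_exp_neg_mul_Ioi (a := a + 1) (by linarith) hb
    simpa using this

lemma Jdiff {α : ℝ} (hα : α ∈ Set.Ioo (0:ℝ) 2) : ∃ C > 0, ∀ j ≤ 1, ∀ y ε : ℝ, 1 ≤ y → 0 ≤ ε →
    ‖(∫ x : ℝ, Gf α j (q1 α y ε) (x + (0:ℝ) * Complex.I))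
      - ∫ x : ℝ, Gf α j (q0 y) (x + (Real.pi / 2 : ℝ) * Complex.I)‖ ≤
      C * y ^ (-(α + 1)) * (1 / Real.sqrt y + ε) := by
  have hα0 := hα.1
  have hpi := Real.pi_pos
  let g : ℝ → ℝ := fun a => 2 ^ (a + 1) * Real.Gamma (a + 1)
  have hg : ∀ a, 0 ≤ a → 0 < g a := fun a ha => by
    have := Real.Gamma_pos_of_pos (s := a + 1) (by linarith)
    positivity
  have h1 := hg (α + 3) (by linarith)
  have h2 := hg (α + 1) (by linarith)
  have h3 := hg (3 * α) (by linarith)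
  have h4 := hg α (by linarith)
  refine ⟨(8 + 8 / α) * (g (α + 3) + g (α + 1) + g (3 * α) + g α), by positivity, ?_⟩
  intro j hj y ε hy hε
  have hy0 : 0 < y := by linarith
  obtain ⟨i1, e1⟩ := shift1 hα hj y ε hy hε
  obtain ⟨i0, e0⟩ := shift0 hα hj y hy
  rw [e1, ← e0, ← integral_sub (i1 _ (by positivity) le_rfl) (i0 _ le_rfl (by linarith)), int_exp_sub]
  have hGi : ∀ a : ℝ, 0 ≤ a → ∫ t in Ioi (0:ℝ), t ^ a * Real.exp (-(y / 2 * t)) = g a * y ^ (-(a + 1)) := by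
    intro a ha
    rw [(gam_int (by linarith) (by positivity)).2, one_div_div, Real.div_rpow (by norm_num) hy0.le,
      Real.rpow_neg hy0.le]
    simp only [g]; ring
  have hI : ∀ a : ℝ, 0 ≤ a → IntegrableOn (fun t : ℝ => t ^ a * Real.exp (-(y / 2 * t))) (Ioi 0) :=
    fun a ha => (gam_int (by linarith) (by positivity)).1
  set K := 8 + 8 / α with hK
  have hK0 : 0 < K := by positivity
  let B : ℝ → ℝ := fun t => K * ((t ^ (α + 3) * Real.exp (-(y / 2 * t)) + t ^ (α + 1) * Real.exp (-(y / 2 * t)))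
      + ε * (t ^ (3 * α) * Real.exp (-(y / 2 * t)) + t ^ α * Real.exp (-(y / 2 * t))))
  have J1 := hI (α + 3) (by linarith)
  have J2 := hI (α + 1) (by linarith)
  have J3 := hI (3 * α) (by linarith)
  have J4 := hI α (by linarith)
  have hB : IntegrableOn B (Ioi 0) := ((J1.add J2).add ((J3.add J4).const_mul ε)).const_mul K
  have hBi : ∫ t in Ioi (0:ℝ), B t = K * ((g (α + 3) * y ^ (-(α + 3 + 1)) + g (α + 1) * y ^ (-(α + 1 + 1)))
      + ε * (g (3 * α) * y ^ (-(3 * α + 1)) + g α * y ^ (-(α + 1)))) := by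
    simp only [B]
    have J12 : IntegrableOn (fun t : ℝ => t ^ (α + 3) * Real.exp (-(y / 2 * t))
      + t ^ (α + 1) * Real.exp (-(y / 2 * t))) (Ioi 0) := J1.add J2
    have J34 : IntegrableOn (fun t : ℝ => ε * (t ^ (3 * α) * Real.exp (-(y / 2 * t))
      + t ^ α * Real.exp (-(y / 2 * t)))) (Ioi 0) := (J3.add J4).const_mul ε
    rw [integral_const_mul, integral_add J12 J34, integral_add J1 J2,
      integral_const_mul, integral_add J3 J4, hGi _ (by linarith), hGi _ (by linarith), hGi _ (by linarith),
      hGi _ (by linarith)]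
  have hle : ‖∫ t in Ioi (0:ℝ), ((t⁻¹ : ℝ) : ℂ) * (Gf α j (q1 α y ε) (Real.log t + (Real.pi / 6 : ℝ) * Complex.I)
      - Gf α j (q0 y) (Real.log t + (Real.pi / 6 : ℝ) * Complex.I))‖ ≤ ∫ t in Ioi (0:ℝ), B t := by
    apply norm_integral_le_of_norm_le hB
    filter_upwards [ae_restrict_mem measurableSet_Ioi] with t ht
    refine (diff_pt hα hj y ε t hε ht).trans (le_of_eq ?_)
    simp only [B]; ring
  refine hle.trans ?_
  rw [hBi]
  have hyp : ∀ a b : ℝ, a ≤ b → y ^ a ≤ y ^ b := fun a b h => Real.rpow_le_rpow_of_exponent_le hy h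
  have hsq : y ^ (-(α + 1)) * (1 / Real.sqrt y) = y ^ (-(α + 1) - 1/2) := by
    rw [Real.sqrt_eq_rpow, one_div, ← Real.rpow_neg hy0.le, ← Real.rpow_add hy0]; ring_nf
  have a1 := hyp (-(α + 3 + 1)) (-(α + 1) - 1/2) (by linarith)
  have a2 := hyp (-(α + 1 + 1)) (-(α + 1) - 1/2) (by linarith)
  have a3 := hyp (-(3 * α + 1)) (-(α + 1)) (by linarith)
  have p1 : 0 < y ^ (-(α + 1) - 1/2) := by positivity
  have p2 : 0 < y ^ (-(α + 1)) := by positivity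
  calc _ ≤ K * ((g (α + 3) * y ^ (-(α + 1) - 1/2) + g (α + 1) * y ^ (-(α + 1) - 1/2))
      + ε * (g (3 * α) * y ^ (-(α + 1)) + g α * y ^ (-(α + 1)))) := by gcongr
    _ = K * (g (α + 3) + g (α + 1)) * y ^ (-(α + 1) - 1/2) + K * (g (3 * α) + g α) * (ε * y ^ (-(α + 1))) := by ring
    _ ≤ K * (g (α + 3) + g (α + 1) + g (3 * α) + g α) * y ^ (-(α + 1) - 1/2)
        + K * (g (α + 3) + g (α + 1) + g (3 * α) + g α) * (ε * y ^ (-(α + 1))) := by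
        apply add_le_add
        · apply mul_le_mul_of_nonneg_right _ p1.le
          apply mul_le_mul_of_nonneg_left _ hK0.le
          linarith
        · apply mul_le_mul_of_nonneg_right _ (by positivity)
          apply mul_le_mul_of_nonneg_left _ hK0.le
          linarith
    _ = _ := by rw [← hsq]; ring

/-- real integrals -/
def T0 (y α : ℝ) : ℝ := ∫ t in Ioi (0:ℝ), t ^ α * Real.exp (-(y * t))
def T1 (y α : ℝ) : ℝ := ∫ t in Ioi (0:ℝ), Real.log t * (t ^ α * Real.exp (-(y * t)))

lemma T_deriv (y α : ℝ) (hy : 0 < y) (hα : 0 < α) :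
    IntegrableOn (fun t : ℝ => Real.log t * (t ^ α * Real.exp (-(y * t)))) (Ioi 0) ∧
    HasDerivAt (T0 y) (T1 y α) α := by
  unfold T0 T1
  have hs : Ioo (α / 2) (α + 1) ∈ 𝓝 α := Ioo_mem_nhds (by linarith) (by linarith)
  let bd : ℝ → ℝ := fun t => (2 + 2 / (α / 2)) * (t ^ α * Real.exp (-(y * t))
     + t ^ (0:ℝ) * Real.exp (-(y * t)) +
     t ^ (α + 1 + α / 2) * Real.exp (-(y * t)) + t ^ (α + 1 - α / 2) * Real.exp (-(y * t)))
  have key := hasDerivAt_integral_of_dominated_loc_of_deriv_le (μ := volume.restrict (Ioi (0:ℝ)))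
    (F := fun (a t : ℝ) => t ^ a * Real.exp (-(y * t))) (x₀ := α) hs
    (F' := fun (a t : ℝ) => Real.log t * (t ^ a * Real.exp (-(y * t)))) (bound := bd) ?_ ?_ ?_ ?_ ?_ ?_
  · exact key
  · refine Filter.Eventually.of_forall fun a => ?_
    exact (by fun_prop : Measurable fun t : ℝ => t ^ a * Real.exp (-(y * t))).aestronglyMeasurable
  · exact (gam_int (by linarith) hy).1
  · exact (by fun_prop : Measurable fun t : ℝ => Real.log t * (t ^ α * Real.exp (-(y * t)))).aestronglyMeasurable
  · filter_upwards [ae_restrict_mem measurableSet_Ioi] with t ht a ha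
    have ht : 0 < t := ht
    have hl := abs_log_le' (α := α / 2) (by linarith) ht
    have hE := Real.exp_pos (-(y * t))
    rw [Real.norm_eq_abs, abs_mul, abs_of_pos (by positivity : 0 < t ^ a * Real.exp (-(y * t)))]
    have hta : t ^ a ≤ t ^ (α / 2) + t ^ (α + 1) := by
      rcases le_total 1 t with h | h
      · have := Real.rpow_le_rpow_of_exponent_le h ha.2.le
        have : 0 < t ^ (α / 2) := by positivity
        linarith
      · have := Real.rpow_le_rpow_of_exponent_ge ht h ha.1.le
        have : 0 < t ^ (α + 1) := by positivity
        linarith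
    set k := 2 + 2 / (α / 2) with hk
    have hk0 : 0 < k := by positivity
    calc |Real.log t| * (t ^ a * Real.exp (-(y * t)))
        ≤ (k * (t ^ (α / 2) + t ^ (-(α / 2)))) * ((t ^ (α / 2) + t ^ (α + 1)) * Real.exp (-(y * t))) := by
          gcongr; linarith
      _ = k * Real.exp (-(y * t)) * (t ^ (α / 2) * t ^ (α / 2) + t ^ (-(α / 2)) * t ^ (α / 2) +
            t ^ (α + 1) * t ^ (α / 2) + t ^ (α + 1) * t ^ (-(α / 2))) := by ring
      _ = bd t := by
          simp only [bd]
          rw [← Real.rpow_add ht, ← Real.rpow_add ht, ← Real.rpow_add ht, ← Real.rpow_add ht,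
            show α / 2 + α / 2 = α by ring, show -(α / 2) + α / 2 = 0 by ring,
            show α + 1 + -(α / 2) = α + 1 - α / 2 by ring]
          ring
  · have hI : ∀ a : ℝ, 0 ≤ a → IntegrableOn (fun t : ℝ => t ^ a * Real.exp (-(y * t))) (Ioi 0) :=
      fun a ha => (gam_int (by linarith) hy).1
    exact ((((hI α hα.le).add (hI 0 le_rfl)).add (hI (α + 1 + α / 2) (by linarith))).add
      (hI (α + 1 - α / 2) (by linarith))).const_mul _
  · filter_upwards [ae_restrict_mem measurableSet_Ioi] with t ht a ha
    have ht : 0 < t := ht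
    have := ((hasDerivAt_id a).const_rpow ht).mul_const (Real.exp (-(y * t)))
    exact this.congr_deriv (by simp only [id]; ring)

lemma M_int {α : ℝ} (hα : α ∈ Set.Ioo (0:ℝ) 2) (y : ℝ) (hy : 1 ≤ y) :
    (∫ x : ℝ, Gf α 0 (q0 y) (x + (Real.pi / 2 : ℝ) * Complex.I)).re = -Real.sin (Real.pi * α / 2) * T0 y α ∧
    (∫ x : ℝ, Gf α 1 (q0 y) (x + (Real.pi / 2 : ℝ) * Complex.I)).re =
      -Real.sin (Real.pi * α / 2) * T1 y α - Real.pi / 2 * Real.cos (Real.pi * α / 2) * T0 y α := by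
  have hy0 : 0 < y := by linarith
  have hpt : ∀ t : ℝ, 0 < t → ((t⁻¹ : ℝ) : ℂ) * (Complex.exp ((α + 1) * (Real.log t + (Real.pi / 2 : ℝ) * Complex.I))
      * Complex.exp (q0 y (Real.log t + (Real.pi / 2 : ℝ) * Complex.I)))
      = ((t ^ α * Real.exp (-(y * t)) : ℝ) : ℂ) * ((-Real.sin (Real.pi * α / 2) : ℝ) + (Real.cos (Real.pi * α / 2) : ℝ) * Complex.I) := by
    intro t ht
    have h1 : Complex.exp (Real.log t + (Real.pi / 2 : ℝ) * Complex.I) = t * Complex.I := by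
      rw [Complex.exp_add, ← Complex.ofReal_exp, Real.exp_log ht]
      congr 1
      push_cast
      exact Complex.exp_pi_div_two_mul_I
    have h2 : Complex.exp (q0 y (Real.log t + (Real.pi / 2 : ℝ) * Complex.I)) = ((Real.exp (-(y * t)) : ℝ) : ℂ) := by
      rw [q0, h1, Complex.ofReal_exp]
      congr 1
      push_cast
      linear_combination (y * t : ℂ) * Complex.I_mul_I
    have h3 : ((α:ℂ) + 1) * (Real.log t + (Real.pi / 2 : ℝ) * Complex.I) =
        (((α + 1) * Real.log t : ℝ) : ℂ) + ((Real.pi * α / 2 + Real.pi / 2 : ℝ) : ℂ) * Complex.I := by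
      push_cast; ring
    rw [h2, h3, Complex.exp_add, Complex.exp_mul_I, ← Complex.ofReal_exp, ← Complex.ofReal_cos, ← Complex.ofReal_sin,
      Real.cos_add_pi_div_two, Real.sin_add_pi_div_two]
    have h4 : t⁻¹ * Real.exp ((α + 1) * Real.log t) = t ^ α := by
      rw [mul_comm (α + 1), ← Real.rpow_def_of_pos ht, Real.rpow_add_one ht.ne']; field_simp
    rw [← h4]
    push_cast; ring
  obtain ⟨iT1, -⟩ := T_deriv y α hy0 hα.1
  have iT0 := (gam_int (a := α) (b := y) (by linarith [hα.1]) hy0).1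
  constructor
  · rw [int_exp_sub]
    have : ∫ t in Ioi (0:ℝ), ((t⁻¹ : ℝ) : ℂ) * Gf α 0 (q0 y) (Real.log t + (Real.pi / 2 : ℝ) * Complex.I)
        = ∫ t in Ioi (0:ℝ), ((t ^ α * Real.exp (-(y * t)) : ℝ) : ℂ) * ((-Real.sin (Real.pi * α / 2) : ℝ) + (Real.cos (Real.pi * α / 2) : ℝ) * Complex.I) := by
      refine setIntegral_congr_fun measurableSet_Ioi fun t ht => ?_
      rw [← hpt t ht, Gf]; ring
    rw [this, integral_mul_const, integral_complex_ofReal, ← T0, Complex.re_ofReal_mul]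
    generalize Real.sin (Real.pi * α / 2) = S
    generalize Real.cos (Real.pi * α / 2) = S'
    simp; ring
  · rw [int_exp_sub]
    set c : ℂ := ((-Real.sin (Real.pi * α / 2) : ℝ) + (Real.cos (Real.pi * α / 2) : ℝ) * Complex.I) with hc
    have : ∫ t in Ioi (0:ℝ), ((t⁻¹ : ℝ) : ℂ) * Gf α 1 (q0 y) (Real.log t + (Real.pi / 2 : ℝ) * Complex.I)
        = ∫ t in Ioi (0:ℝ), (((Real.log t * (t ^ α * Real.exp (-(y * t))) : ℝ) : ℂ) * c
          + ((t ^ α * Real.exp (-(y * t)) : ℝ) : ℂ) * (((Real.pi / 2 : ℝ) : ℂ) * Complex.I * c)) := by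
      refine setIntegral_congr_fun measurableSet_Ioi fun t ht => ?_
      have := hpt t ht
      rw [Gf, pow_one]
      rw [Complex.ofReal_mul (Real.log t)]
      linear_combination (Real.log t + (Real.pi / 2 : ℝ) * Complex.I) * this
    rw [this, integral_add, integral_mul_const, integral_mul_const, integral_complex_ofReal, integral_complex_ofReal, ← T0, ← T1,
      Complex.add_re, Complex.re_ofReal_mul, Complex.re_ofReal_mul, mul_assoc, Complex.re_ofReal_mul, hc]
    · generalize Real.sin (Real.pi * α / 2) = S
      generalize Real.cos (Real.pi * α / 2) = S'
      simp; ring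
    · exact (iT1.ofReal).mul_const _
    · exact (iT0.ofReal).mul_const _

lemma cAlpha_eq {α : ℝ} (hα : α ∈ Set.Ioo (0:ℝ) 2) :
    cAlpha α = Real.Gamma (α + 1) * Real.sin (Real.pi * α / 2) / Real.pi := by
  obtain ⟨h0, h2⟩ := hα
  have hpi := Real.pi_pos
  unfold cAlpha
  split_ifs with h
  · subst h
    have : Real.Gamma (1 + 1) = 1 := by norm_num
    rw [this]; simp
  · have hsin : 0 < Real.sin (Real.pi * α / 2) := Real.sin_pos_of_pos_of_lt_pi (by positivity) (by nlinarith)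
    have hcos : Real.cos (Real.pi * α / 2) ≠ 0 := by
      intro hc
      rw [Real.cos_eq_zero_iff] at hc
      obtain ⟨k, hk⟩ := hc
      have hk' : α = 2 * k + 1 := by
        field_simp at hk; linarith
      have k1 : (-1 : ℝ) < k := by linarith
      have k2 : (k : ℝ) < 1 := by linarith
      have k3 : (-1 : ℤ) < k := by exact_mod_cast k1
      have k4 : k < (1 : ℤ) := by exact_mod_cast k2
      have : k = 0 := by omega
      rw [this] at hk'
      apply h; simpa using hk'
    have hr := Real.Gamma_mul_Gamma_one_sub α
    have hs2 : Real.sin (Real.pi * α) = 2 * Real.sin (Real.pi * α / 2) * Real.cos (Real.pi * α / 2) := by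
      rw [← Real.sin_two_mul]; ring_nf
    have hG2 : Real.Gamma (2 - α) = (1 - α) * Real.Gamma (1 - α) := by
      rw [show 2 - α = (1 - α) + 1 by ring, Real.Gamma_add_one]
      intro h'; apply h; linarith
    have hG1 := Real.Gamma_add_one h0.ne'
    have hp2 : Real.Gamma (2 - α) ≠ 0 := (Real.Gamma_pos_of_pos (by linarith)).ne'
    have h1a : 1 - α ≠ 0 := fun h' => h (by linarith)
    have hp1 : Real.Gamma (1 - α) ≠ 0 := by
      intro h'; rw [h', mul_zero] at hG2; exact hp2 hG2
    rw [hs2] at hr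
    rw [hG2, hG1]
    have hr' : Real.Gamma α = Real.pi / (2 * Real.sin (Real.pi * α / 2) * Real.cos (Real.pi * α / 2)) / Real.Gamma (1 - α) := by
      rw [← hr]; field_simp
    rw [hr']
    have hsin' := hsin.ne'
    generalize Real.sin (Real.pi * α / 2) = S at *
    generalize Real.cos (Real.pi * α / 2) = S' at *
    field_simp
    ring

lemma M_vals {α : ℝ} (hα : α ∈ Set.Ioo (0:ℝ) 2) (y : ℝ) (hy : 1 ≤ y) :
    (∫ x : ℝ, Gf α 0 (q0 y) (x + (Real.pi / 2 : ℝ) * Complex.I)).re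
      = -Real.pi * (cAlpha α * y ^ (-(α + 1))) ∧
    (∫ x : ℝ, Gf α 1 (q0 y) (x + (Real.pi / 2 : ℝ) * Complex.I)).re =
      -Real.pi * ((deriv cAlpha α - cAlpha α * Real.log y) * y ^ (-(α + 1))) := by
  obtain ⟨m0, m1⟩ := M_int hα y hy
  have hy0 : 0 < y := by linarith
  have hpi := Real.pi_pos
  have hT : ∀ a ∈ Set.Ioo (0:ℝ) 2, T0 y a = y ^ (-(a + 1)) * Real.Gamma (a + 1) := by
    intro a ha
    rw [T0, (gam_int (by linarith [ha.1]) hy0).2, one_div, Real.inv_rpow hy0.le, Real.rpow_neg hy0.le]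
  have hf : ∀ a ∈ Set.Ioo (0:ℝ) 2, -Real.sin (Real.pi * a / 2) * T0 y a = -Real.pi * (cAlpha a * y ^ (-(a + 1))) := by
    intro a ha
    rw [hT a ha, cAlpha_eq ha]; field_simp
  refine ⟨by rw [m0, hf α hα], ?_⟩
  rw [m1]
  have hnh : Set.Ioo (0:ℝ) 2 ∈ 𝓝 α := Ioo_mem_nhds hα.1 hα.2
  have dc : DifferentiableAt ℝ cAlpha α := by
    have hev : cAlpha =ᶠ[𝓝 α] fun a => Real.Gamma (a + 1) * Real.sin (Real.pi * a / 2) / Real.pi := by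
      filter_upwards [hnh] with a ha using cAlpha_eq ha
    refine DifferentiableAt.congr_of_eventuallyEq ?_ hev
    have : DifferentiableAt ℝ Real.Gamma (α + 1) := by
      apply Real.differentiableAt_Gamma
      intro m
      have : (0:ℝ) ≤ m := by positivity
      have := hα.1
      intro h; linarith
    have : DifferentiableAt ℝ (fun a => Real.Gamma (a + 1)) α := DifferentiableAt.comp (g := Real.Gamma) (f := fun a : ℝ => a + 1) α this (by fun_prop)
    fun_prop
  have d1 : HasDerivAt (fun a => -Real.sin (Real.pi * a / 2) * T0 y a)
      (-Real.sin (Real.pi * α / 2) * T1 y α - Real.pi / 2 * Real.cos (Real.pi * α / 2) * T0 y α) α := by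
    have hs : HasDerivAt (fun a : ℝ => -Real.sin (Real.pi * a / 2)) (-(Real.cos (Real.pi * α / 2) * (Real.pi * 1 / 2))) α :=
      ((((hasDerivAt_id α).const_mul Real.pi).div_const 2).sin).neg
    exact (hs.mul (T_deriv y α hy0 hα.1).2).congr_deriv (by ring)
  have d2 : HasDerivAt (fun a => -Real.pi * (cAlpha a * y ^ (-(a + 1))))
      (-Real.pi * ((deriv cAlpha α - cAlpha α * Real.log y) * y ^ (-(α + 1)))) α := by
    have hr : HasDerivAt (fun a : ℝ => y ^ (-(a + 1))) (Real.log y * (-1) * y ^ (-(α + 1))) α :=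
      (((hasDerivAt_id α).add_const 1).neg).const_rpow hy0
    exact ((dc.hasDerivAt.mul hr).const_mul (-Real.pi)).congr_deriv (by ring)
  have hev : (fun a => -Real.sin (Real.pi * a / 2) * T0 y a) =ᶠ[𝓝 α] fun a => -Real.pi * (cAlpha a * y ^ (-(a + 1))) := by
    filter_upwards [hnh] with a ha using hf a ha
  exact d1.unique (d2.congr_of_eventuallyEq hev)

/-- Fourier integrals -/
def HK (α : ℝ) (j : ℕ) (y ε : ℝ) : ℝ :=
  ∫ u : ℝ, Real.cos (y * u) * Real.exp (-(u ^ 2) / 2) * (|u| ^ α * Real.log |u| ^ j * Real.exp (-(ε * |u| ^ α)))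

lemma HK_eq {α : ℝ} (hα : α ∈ Set.Ioo (0:ℝ) 2) {j : ℕ} (hj : j ≤ 1) (y ε : ℝ) (hy : 1 ≤ |y|) (hε : 0 ≤ ε) :
    HK α j y ε = 2 * (∫ x : ℝ, Gf α j (q1 α |y| ε) (x + (0:ℝ) * Complex.I)).re := by
  have hi := (shift1 hα hj |y| ε hy hε).1 0 le_rfl (by positivity)
  rw [int_exp_sub]
  have hi2 := int_exp_integrable _ hi
  have hre := integral_re hi2
  simp only [RCLike.re_to_complex] at hre
  rw [← hre]
  have hpt : ∀ t ∈ Ioi (0:ℝ), (((t⁻¹ : ℝ) : ℂ) * Gf α j (q1 α |y| ε) (Real.log t + (0:ℝ) * Complex.I)).re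
      = Real.cos (|y| * t) * Real.exp (-(t ^ 2) / 2) * (t ^ α * Real.log t ^ j * Real.exp (-(ε * t ^ α))) := by
    intro t ht
    have ht : 0 < t := ht
    have hpow : ∀ a : ℝ, Complex.exp (a * Real.log t) = ((t ^ a : ℝ) : ℂ) := fun a => by
      rw [Real.rpow_def_of_pos ht, mul_comm (Real.log t)]; push_cast; rfl
    have h1 : Complex.exp (Real.log t) = t := by rw [← Complex.ofReal_exp, Real.exp_log ht]
    have h2 : Complex.exp (2 * Real.log t) = ((t ^ 2 : ℝ) : ℂ) := by
      have := hpow 2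
      simpa using this
    have h3 := hpow (α + 1)
    push_cast at h3
    simp only [Gf, q1, q0, Complex.ofReal_zero, zero_mul, add_zero]
    rw [h1, h2, hpow α, h3]
    have e : Complex.I * |y| * t - (((t ^ 2 : ℝ) : ℂ) / 2 + ε * ((t ^ α : ℝ) : ℂ))
      = ((-(t ^ 2) / 2 + -(ε * t ^ α) : ℝ) : ℂ) + ((|y| * t : ℝ) : ℂ) * Complex.I := by
      push_cast; ring
    rw [e, Complex.exp_add, Complex.exp_mul_I, ← Complex.ofReal_exp, ← Complex.ofReal_cos, ← Complex.ofReal_sin]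
    have h4 : t⁻¹ * t ^ (α + 1) = t ^ α := by
      rw [Real.rpow_add_one ht.ne']; field_simp
    rw [Real.exp_add]
    have e2 : ((t⁻¹ : ℝ) : ℂ) * ((Real.log t : ℂ) ^ j * ((t ^ (α + 1) : ℝ) : ℂ) *
      (((Real.exp (-(t ^ 2) / 2) * Real.exp (-(ε * t ^ α)) : ℝ) : ℂ) *
        (((Real.cos (|y| * t) : ℝ) : ℂ) + ((Real.sin (|y| * t) : ℝ) : ℂ) * Complex.I)))
      = ((t⁻¹ * (Real.log t ^ j * t ^ (α + 1) * (Real.exp (-(t ^ 2) / 2) * Real.exp (-(ε * t ^ α)))) : ℝ) : ℂ) *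
        (((Real.cos (|y| * t) : ℝ) : ℂ) + ((Real.sin (|y| * t) : ℝ) : ℂ) * Complex.I) := by
      push_cast; ring
    rw [e2, Complex.re_ofReal_mul]
    have e3 : (((Real.cos (|y| * t) : ℝ) : ℂ) + ((Real.sin (|y| * t) : ℝ) : ℂ) * Complex.I).re = Real.cos (|y| * t) := by
      generalize Real.cos (|y| * t) = a
      generalize Real.sin (|y| * t) = b
      simp
    rw [e3]
    linear_combination (Real.log t ^ j * (Real.exp (-(t ^ 2) / 2) * Real.exp (-(ε * t ^ α))) * Real.cos (|y| * t)) * h4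
  rw [setIntegral_congr_fun measurableSet_Ioi hpt, ← integral_comp_abs, HK]
  congr 1; ext u
  rw [sq_abs, ← abs_mul, Real.cos_abs]

lemma HK_asymp {α : ℝ} (hα : α ∈ Set.Ioo (0:ℝ) 2) : ∃ C > 0, ∀ y ε : ℝ, 1 ≤ |y| → 0 ≤ ε →
    |(2 * Real.pi)⁻¹ * HK α 0 y ε + cAlpha α * |y| ^ (-(α + 1))|
      ≤ C * |y| ^ (-(α + 1)) * (1 / Real.sqrt |y| + ε) ∧
    |(2 * Real.pi)⁻¹ * HK α 1 y ε + (deriv cAlpha α - cAlpha α * Real.log |y|) * |y| ^ (-(α + 1))|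
      ≤ C * |y| ^ (-(α + 1)) * (1 / Real.sqrt |y| + ε) := by
  obtain ⟨C, hC, h⟩ := Jdiff hα
  have hpi := Real.pi_pos
  have hpi1 : 1 ≤ Real.pi := by linarith [Real.pi_gt_three]
  refine ⟨C, hC, fun y ε hy hε => ?_⟩
  obtain ⟨m0, m1⟩ := M_vals hα |y| hy
  have gen : ∀ (J M : ℂ) (c B : ℝ), ‖J - M‖ ≤ B → M.re = -Real.pi * c →
      |(2 * Real.pi)⁻¹ * (2 * J.re) + c| ≤ B := by
    intro J M c B hB hM
    have e : (2 * Real.pi)⁻¹ * (2 * J.re) + c = Real.pi⁻¹ * (J - M).re := by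
      rw [Complex.sub_re, hM]; field_simp; ring
    rw [e, abs_mul, abs_of_pos (inv_pos.mpr hpi)]
    have h1 : Real.pi⁻¹ ≤ 1 := inv_le_one_of_one_le₀ hpi1
    have h2 := (Complex.abs_re_le_norm (J - M)).trans hB
    have := abs_nonneg (J - M).re
    nlinarith
  constructor
  · rw [HK_eq hα (by norm_num) y ε hy hε]
    exact gen _ _ _ _ (h 0 (by norm_num) |y| ε hy hε) m0
  · rw [HK_eq hα le_rfl y ε hy hε]
    exact gen _ _ _ _ (h 1 le_rfl |y| ε hy hε) m1

lemma gauss_cont : Continuous gauss := by unfold gauss; fun_prop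

lemma gauss_integrable : Integrable gauss := by
  unfold gauss
  have := (integrable_exp_neg_mul_sq (b := 1/2) (by norm_num)).const_mul (Real.sqrt (2 * Real.pi))⁻¹
  refine this.congr (Filter.Eventually.of_forall fun x => ?_)
  simp only
  congr 2; ring

lemma gauss_fourier (s : ℝ) :
    ∫ x : ℝ, ((gauss x : ℝ) : ℂ) * Complex.exp (Complex.I * s * x) = ((Real.exp (-(s ^ 2) / 2) : ℝ) : ℂ) := by
  have h := fourierIntegral_gaussian (b := 1/2) (by norm_num) s
  have hpi := Real.pi_pos
  have e : ∀ x : ℝ, ((gauss x : ℝ) : ℂ) * Complex.exp (Complex.I * s * x) =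
     (((Real.sqrt (2 * Real.pi))⁻¹ : ℝ) : ℂ) * (Complex.exp (Complex.I * s * x) * Complex.exp (-(1/2) * x ^ 2)) := by
    intro x
    rw [gauss]
    push_cast
    rw [show -(x:ℂ)^2 / 2 = -(1/2) * x ^ 2 by ring]; ring
  simp_rw [e]
  rw [integral_const_mul, h]
  have h2 : ((Real.pi : ℂ) / (1/2)) ^ (1/2 : ℂ) = ((Real.sqrt (2 * Real.pi) : ℝ) : ℂ) := by
    rw [Real.sqrt_eq_rpow, Complex.ofReal_cpow (by positivity)]
    push_cast
    congr 1; ring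
  rw [h2, ← mul_assoc, ← Complex.ofReal_mul, inv_mul_cancel₀ (by positivity)]
  push_cast
  rw [one_mul]; congr 1; ring

lemma gauss_cos (s y : ℝ) : ∫ x : ℝ, gauss x * Real.cos ((y - x) * s) = Real.cos (y * s) * Real.exp (-(s ^ 2) / 2) := by
  have h := gauss_fourier (-s)
  have hi : Integrable (fun x : ℝ => Complex.exp (Complex.I * (y * s : ℝ)) * (((gauss x : ℝ) : ℂ) * Complex.exp (Complex.I * (-s : ℝ) * x))) := by
    apply Integrable.const_mul
    refine Integrable.mono gauss_integrable ?_ ?_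
    · have := gauss_cont
      exact (by fun_prop : Continuous fun x : ℝ => ((gauss x : ℝ) : ℂ) * Complex.exp (Complex.I * (-s : ℝ) * x)).aestronglyMeasurable
    · refine Filter.Eventually.of_forall fun x => ?_
      rw [norm_mul, Complex.norm_exp]; simp
  have h2 := integral_re hi
  rw [integral_const_mul, h] at h2
  simp only [RCLike.re_to_complex] at h2
  have e1 : ∀ x : ℝ, (Complex.exp (Complex.I * (y * s : ℝ)) * (((gauss x : ℝ) : ℂ) * Complex.exp (Complex.I * (-s : ℝ) * x))).re
      = gauss x * Real.cos ((y - x) * s) := by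
    intro x
    have : Complex.exp (Complex.I * (y * s : ℝ)) * (((gauss x : ℝ) : ℂ) * Complex.exp (Complex.I * (-s : ℝ) * x))
      = (gauss x : ℂ) * Complex.exp (((y - x) * s : ℝ) * Complex.I) := by
      rw [mul_left_comm, ← Complex.exp_add]; push_cast; ring_nf
    rw [this, Complex.re_ofReal_mul, Complex.exp_ofReal_mul_I_re]
  simp_rw [e1] at h2
  rw [h2, mul_comm (Complex.exp _), Complex.re_ofReal_mul, mul_comm Complex.I, Complex.exp_ofReal_mul_I_re]
  rw [neg_sq]; ring

lemma gauss_conv (u y w : ℝ) (hw : 0 < w) :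
    ∫ z : ℝ, gauss (y - w * z) * Real.cos (z * u) = w⁻¹ * (Real.cos (y * (w⁻¹ * u)) * Real.exp (-((w⁻¹ * u) ^ 2) / 2)) := by
  rw [← gauss_cos]
  have h1 := integral_sub_left_eq_self (fun x : ℝ => gauss x * Real.cos ((y - x) * (w⁻¹ * u))) volume y
  have h2 := Measure.integral_comp_mul_left (fun x : ℝ => gauss (y - x) * Real.cos ((y - (y - x)) * (w⁻¹ * u))) w
  rw [h1, abs_of_pos (inv_pos.mpr hw), smul_eq_mul] at h2
  rw [← h2]
  congr 1; ext z
  congr 2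
  field_simp; ring

lemma fubini (B : ℝ → ℝ) (hB : Integrable B) (y w : ℝ) (hw : 0 < w) :
    ∫ z : ℝ, gauss (y - w * z) * ∫ u : ℝ, Real.cos (z * u) * B u
      = ∫ u : ℝ, Real.cos (y * u) * Real.exp (-(u ^ 2) / 2) * B (w * u) := by
  have hg : Integrable (fun z : ℝ => gauss (y - w * z)) := by
    have h1 : Integrable (fun z : ℝ => gauss (y - z)) := gauss_integrable.comp_sub_left y
    exact h1.comp_mul_left' hw.ne'
  have hIntg : Integrable (Function.uncurry fun (z u : ℝ) => gauss (y - w * z) * (Real.cos (z * u) * B u)) (volume.prod volume) := by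
    have := (hg.mul_prod hB)
    refine Integrable.mono this ?_ ?_
    · have h2 : Continuous (fun p : ℝ × ℝ => Real.cos (p.1 * p.2)) := by fun_prop
      refine (h2.aestronglyMeasurable.mul this.aestronglyMeasurable).congr (Filter.Eventually.of_forall fun p => ?_)
      simp [Function.uncurry]; ring
    · refine Filter.Eventually.of_forall fun p => ?_
      simp only [Function.uncurry, norm_mul]
      have : ‖Real.cos (p.1 * p.2)‖ ≤ 1 := Real.abs_cos_le_one _
      have h3 : ‖Real.cos (p.1 * p.2)‖ * ‖B p.2‖ ≤ ‖B p.2‖ := by nlinarith [norm_nonneg (B p.2)]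
      gcongr
  simp_rw [← integral_const_mul]
  rw [integral_integral_swap hIntg]
  have e : ∀ u : ℝ, ∫ z : ℝ, gauss (y - w * z) * (Real.cos (z * u) * B u)
     = w⁻¹ * (Real.cos (y * (w⁻¹ * u)) * Real.exp (-((w⁻¹ * u) ^ 2) / 2) * B (w * (w⁻¹ * u))) := by
    intro u
    simp_rw [← mul_assoc]
    rw [integral_mul_const, gauss_conv u y w hw, mul_inv_cancel₀ hw.ne', one_mul]; ring_nf
  simp_rw [e]
  rw [integral_const_mul, Measure.integral_comp_mul_left (fun v : ℝ => Real.cos (y * v) * Real.exp (-(v ^ 2) / 2) * B (w * v)) w⁻¹,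
    inv_inv, abs_of_pos hw, smul_eq_mul, ← mul_assoc, inv_mul_cancel₀ hw.ne', one_mul]

lemma iEb {α : ℝ} (hα : 0 < α) {s b : ℝ} (hs : -1 < s) (hb : 0 < b) :
    Integrable (fun u : ℝ => |u| ^ s * Real.exp (-(b * |u| ^ α))) := by
  have := integrable_abs_of (f := fun x => x ^ s * Real.exp (-b * x ^ α))
    (integrableOn_rpow_mul_exp_neg_mul_rpow hs hα hb)
  simpa only [neg_mul] using this

lemma iE {α : ℝ} (hα : 0 < α) {s : ℝ} (hs : -1 < s) :
    Integrable (fun u : ℝ => |u| ^ s * Real.exp (-(|u| ^ α))) := by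
  simpa only [one_mul] using iEb hα hs one_pos

lemma iJb {α b : ℝ} (hα : 0 < α) (hb : 0 < b) {j : ℕ} (hj : j ≤ 1) :
    Integrable (fun u : ℝ => |u| ^ α * Real.log |u| ^ j * Real.exp (-(b * |u| ^ α))) := by
  have h := ((iEb hα (s := α + α) (by linarith) hb).add (iEb hα (s := 0) (by norm_num) hb)).const_mul (2 + 2 / α)
  refine Integrable.mono' h (by fun_prop (disch := exact hα.le)) (Eventually.of_forall fun u => ?_)
  simp only [Pi.add_apply]
  by_cases hu : u = 0
  · subst hu
    simp only [abs_zero, Real.zero_rpow hα.ne', zero_mul, norm_zero]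
    positivity
  have ht : 0 < |u| := abs_pos.mpr hu
  have hl := abs_log_le' hα ht
  have e : |u| ^ α * |u| ^ (-α) = 1 := by
    rw [← Real.rpow_add ht]; simp
  rw [Real.rpow_add ht, Real.rpow_zero, norm_mul, norm_mul, norm_pow, Real.norm_eq_abs (Real.log |u|),
    Real.norm_of_nonneg (Real.exp_pos _).le, Real.norm_of_nonneg (by positivity : 0 ≤ |u| ^ α)]
  set M := |Real.log (|u|)| with hM
  have hp : M ^ j ≤ 1 + M := by
    have : 0 ≤ M := abs_nonneg _
    interval_cases j
    · simpa using this
    · simp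
  have hE := Real.exp_pos (-(b * |u| ^ α))
  calc |u| ^ α * M ^ j * Real.exp (-(b * |u| ^ α))
      ≤ |u| ^ α * ((2 + 2 / α) * (|u| ^ α + |u| ^ (-α))) * Real.exp (-(b * |u| ^ α)) := by
        gcongr; exact hp.trans hl
    _ = (2 + 2 / α) * (|u| ^ α * |u| ^ α * Real.exp (-(b * |u| ^ α)) + (|u| ^ α * |u| ^ (-α)) * Real.exp (-(b * |u| ^ α))) := by ring
    _ = _ := by rw [e]

lemma iJ {α : ℝ} (hα : 0 < α) {j : ℕ} (hj : j ≤ 1) :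
    Integrable (fun u : ℝ => |u| ^ α * Real.log |u| ^ j * Real.exp (-(|u| ^ α))) := by
  simpa only [one_mul] using iJb hα one_pos hj

lemma uE_deriv {α : ℝ} (hα : 0 < α) (u : ℝ) :
    HasDerivAt (fun u : ℝ => u * Real.exp (-(|u| ^ α)))
      (Real.exp (-(|u| ^ α)) - α * |u| ^ α * Real.exp (-(|u| ^ α))) u := by
  by_cases hu : u = 0
  · subst hu
    have hc : Continuous (fun u : ℝ => Real.exp (-(|u| ^ α))) := by
      fun_prop (disch := exact hα.le)
    rw [hasDerivAt_iff_tendsto_slope]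
    have h1 : Tendsto (fun u : ℝ => Real.exp (-(|u| ^ α))) (𝓝[≠] 0) (𝓝 (Real.exp (-(|(0:ℝ)| ^ α)))) :=
      hc.continuousAt.tendsto.mono_left nhdsWithin_le_nhds
    have e : Real.exp (-(|(0:ℝ)| ^ α)) - α * |(0:ℝ)| ^ α * Real.exp (-(|(0:ℝ)| ^ α)) = Real.exp (-(|(0:ℝ)| ^ α)) := by
      simp [Real.zero_rpow hα.ne']
    rw [e]
    refine h1.congr' ?_
    filter_upwards [self_mem_nhdsWithin] with x hx
    have hx : x ≠ 0 := hx
    rw [slope_def_field]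
    field_simp
    simp
  · have ht : 0 < |u| := abs_pos.mpr hu
    have h1 := (hasDerivAt_abs hu).rpow_const (p := α) (Or.inl ht.ne')
    have h2 := (hasDerivAt_id u).mul h1.neg.exp
    refine h2.congr_deriv ?_
    have e : |u| ^ α = |u| * |u| ^ (α - 1) := by
      rw [Real.rpow_sub_one ht.ne']; field_simp
    have e2 : ((SignType.sign u : SignType) : ℝ) * u = |u| := sign_mul_self u
    simp only [id, Pi.neg_apply]
    generalize hX : Real.exp (-(|u| ^ α)) = X
    rw [e]
    linear_combination (-X * α * |u| ^ (α - 1)) * e2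

lemma Dop_stable {α : ℝ} (hα : 0 < α) (z : ℝ) :
    Dop (stableDensity α) z = (2 * Real.pi)⁻¹ * ∫ u : ℝ, Real.cos (z * u) * (α * (|u| ^ α * Real.exp (-(|u| ^ α)))) := by
  have i0 : Integrable (fun u : ℝ => Real.exp (-(|u| ^ α))) := by
    simpa using iE hα (s := 0) (by norm_num)
  have i1 : Integrable (fun u : ℝ => |u| * Real.exp (-(|u| ^ α))) := by
    simpa using iE hα (s := 1) (by norm_num)
  have ia := iE hα (s := α) (by linarith)
  have hEm : Continuous (fun u : ℝ => Real.exp (-(|u| ^ α))) := by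
    fun_prop (disch := exact hα.le)
  have ham : Continuous (fun u : ℝ => |u| ^ α) := by
    fun_prop (disch := exact hα.le)
  have ic : ∀ z : ℝ, Integrable (fun u : ℝ => Real.cos (z * u) * Real.exp (-(|u| ^ α))) := by
    intro z
    refine Integrable.mono' i0 (Continuous.aestronglyMeasurable (by fun_prop)) (Eventually.of_forall fun u => ?_)
    rw [norm_mul, Real.norm_of_nonneg (Real.exp_pos _).le]
    exact mul_le_of_le_one_left (Real.exp_pos _).le (Real.abs_cos_le_one _)
  have ica : Integrable (fun u : ℝ => Real.cos (z * u) * (α * (|u| ^ α * Real.exp (-(|u| ^ α))))) := by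
    refine Integrable.mono' (ia.const_mul α) (Continuous.aestronglyMeasurable (by fun_prop)) (Eventually.of_forall fun u => ?_)
    have h0 : 0 ≤ α * (|u| ^ α * Real.exp (-(|u| ^ α))) := by positivity
    rw [norm_mul, Real.norm_of_nonneg h0]
    exact mul_le_of_le_one_left h0 (Real.abs_cos_le_one _)
  have isn : Integrable (fun u : ℝ => -Real.sin (z * u) * u * Real.exp (-(|u| ^ α))) := by
    refine Integrable.mono' i1 (Continuous.aestronglyMeasurable (by fun_prop)) (Eventually.of_forall fun u => ?_)
    rw [norm_mul, norm_mul, Real.norm_of_nonneg (Real.exp_pos _).le, norm_neg, Real.norm_eq_abs u]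
    gcongr
    exact mul_le_of_le_one_left (abs_nonneg _) (Real.abs_sin_le_one _)
  have hd : HasDerivAt (fun z => ∫ u : ℝ, Real.cos (z * u) * Real.exp (-(|u| ^ α)))
      (∫ u : ℝ, -Real.sin (z * u) * u * Real.exp (-(|u| ^ α))) z := by
    refine (hasDerivAt_integral_of_dominated_loc_of_deriv_le (F := fun z u => Real.cos (z * u) * Real.exp (-(|u| ^ α)))
      (F' := fun z u => -Real.sin (z * u) * u * Real.exp (-(|u| ^ α))) (bound := fun u => |u| * Real.exp (-(|u| ^ α)))
      (s := Set.univ) Filter.univ_mem ?_ (ic z) ?_ ?_ i1 ?_).2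
    · exact Eventually.of_forall fun z => (ic z).aestronglyMeasurable
    · exact isn.aestronglyMeasurable
    · refine Eventually.of_forall fun u x _ => ?_
      rw [norm_mul, norm_mul, Real.norm_of_nonneg (Real.exp_pos _).le, norm_neg, Real.norm_eq_abs u]
      gcongr
      exact mul_le_of_le_one_left (abs_nonneg _) (Real.abs_sin_le_one _)
    · refine Eventually.of_forall fun u x _ => ?_
      have := ((hasDerivAt_id x).mul_const u).cos.mul_const (Real.exp (-(|u| ^ α)))
      simpa using this
  have hd2 : deriv (stableDensity α) z = (2 * Real.pi)⁻¹ * ∫ u : ℝ, -Real.sin (z * u) * u * Real.exp (-(|u| ^ α)) :=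
    (hd.const_mul _).deriv
  have hz : ∫ u : ℝ, (z * (-Real.sin (z * u) * u * Real.exp (-(|u| ^ α))) + (Real.cos (z * u) * Real.exp (-(|u| ^ α))
      - Real.cos (z * u) * (α * (|u| ^ α * Real.exp (-(|u| ^ α)))))) = 0 := by
    refine integral_eq_zero_of_hasDerivAt_of_integrable (f := fun u => Real.cos (z * u) * (u * Real.exp (-(|u| ^ α)))) ?_ ?_ ?_
    · intro u
      have := ((hasDerivAt_id u).const_mul z).cos.mul (uE_deriv hα u)
      refine this.congr_deriv ?_
      simp only [id]
      ring
    · exact (isn.const_mul z).add ((ic z).sub ica)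
    · refine Integrable.mono' i1 (Continuous.aestronglyMeasurable (by fun_prop)) (Eventually.of_forall fun u => ?_)
      rw [norm_mul, norm_mul, Real.norm_of_nonneg (Real.exp_pos _).le, Real.norm_eq_abs u]
      exact mul_le_of_le_one_left (by positivity) (Real.abs_cos_le_one _)
  have hzz := integral_add (isn.const_mul z) ((ic z).sub ica)
  simp only [Pi.sub_apply] at hzz
  rw [hzz, integral_sub (ic z) ica, integral_const_mul] at hz
  rw [Dop, hd2, stableDensity]
  linear_combination (2 * Real.pi)⁻¹ * hz

lemma HK_integrable {α : ℝ} (hα : 0 < α) {j : ℕ} (hj : j ≤ 1) (y w : ℝ) (hw : 0 < w) :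
    Integrable (fun u : ℝ => Real.cos (y * u) * Real.exp (-(u ^ 2) / 2) *
      (|u| ^ α * Real.log |u| ^ j * Real.exp (-(w ^ α * |u| ^ α)))) := by
  have h := iJb hα (Real.rpow_pos_of_pos hw α) hj
  refine Integrable.mono h ((Continuous.aestronglyMeasurable (by fun_prop)).mul h.aestronglyMeasurable)
    (Eventually.of_forall fun u => ?_)
  rw [norm_mul]
  refine mul_le_of_le_one_left (norm_nonneg _) ?_
  rw [norm_mul, Real.norm_of_nonneg (Real.exp_pos _).le]
  refine mul_le_one₀ (Real.abs_cos_le_one _) (Real.exp_pos _).le (Real.exp_le_one_iff.mpr ?_)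
  have := sq_nonneg u
  linarith

lemma hFun_eq {α : ℝ} (hα : 0 < α) (y w : ℝ) (hw : 0 < w) :
    hFun α y w = (2 * Real.pi)⁻¹ * (α * (w ^ α * HK α 0 y (w ^ α))) := by
  have h := fubini (fun u => α * (|u| ^ α * Real.exp (-(|u| ^ α)))) ((iE hα (by linarith)).const_mul α) y w hw
  rw [hFun]
  simp only [Dop_stable hα]
  simp only [mul_left_comm (gauss _)]
  rw [integral_const_mul, h, HK]
  congr 1
  rw [← integral_const_mul, ← integral_const_mul]
  congr 1; ext u
  rw [abs_mul, abs_of_pos hw, Real.mul_rpow hw.le (abs_nonneg u)]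
  ring

lemma kFun_eq {α : ℝ} (hα : 0 < α) (y w : ℝ) (hw : 0 < w) :
    kFun α y w = -(2 * Real.pi)⁻¹ * (w ^ α * (HK α 1 y (w ^ α) + Real.log w * HK α 0 y (w ^ α))) := by
  have h := fubini (fun u => |u| ^ α * Real.log |u| ^ 1 * Real.exp (-(|u| ^ α))) (iJ hα le_rfl) y w hw
  have e0 : ∀ z u : ℝ, Real.cos (z * u) * |u| ^ α * Real.log |u| * Real.exp (-(|u| ^ α))
      = Real.cos (z * u) * (|u| ^ α * Real.log |u| ^ 1 * Real.exp (-(|u| ^ α))) := fun z u => by ring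
  rw [kFun]
  simp only [stableDensityDalpha, e0]
  simp only [mul_left_comm (gauss _)]
  rw [integral_const_mul, h, HK, HK]
  congr 1
  rw [← integral_const_mul,
    ← integral_add (HK_integrable hα le_rfl y w hw) ((HK_integrable hα (j := 0) (by norm_num) y w hw).const_mul _), ← integral_const_mul]
  congr 1; ext u
  rw [abs_mul, abs_of_pos hw, Real.mul_rpow hw.le (abs_nonneg u)]
  by_cases hu : u = 0
  · subst hu
    simp [Real.zero_rpow hα.ne']
  rw [Real.log_mul hw.ne' (abs_pos.mpr hu).ne']
  ring

lemma lFun_eq {σ δ α : ℝ} (hσ : 0 < σ) (hδ : 0 < δ) (hα : 0 < α) (n : ℕ) (hn : 1 ≤ n) (y : ℝ) :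
    lFun n α y (wn n σ δ α) = -(wn n σ δ α ^ α) *
      ((Real.log (Real.log n) / 2 + Real.log (δ / σ)) * ((2 * Real.pi)⁻¹ * HK α 0 y (wn n σ δ α ^ α))
        + (2 * Real.pi)⁻¹ * HK α 1 y (wn n σ δ α ^ α)) := by
  have hn0 : (0:ℝ) < n := by exact_mod_cast hn
  have hw : 0 < wn n σ δ α := by unfold wn; positivity
  have hl : Real.log (wn n σ δ α) = (1 / 2 - 1 / α) * Real.log n + Real.log (δ / σ) := by
    unfold wn
    rw [mul_div_assoc, Real.log_mul (by positivity) (by positivity), Real.log_rpow hn0]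
  rw [lFun, hFun_eq hα _ _ hw, kFun_eq hα _ _ hw, hl]
  generalize HK α 0 y (wn n σ δ α ^ α) = H
  generalize HK α 1 y (wn n σ δ α ^ α) = K
  generalize Real.log (Real.log n) = L
  field_simp
  ring

lemma wn_pow {σ δ α : ℝ} (hσ : 0 < σ) (hδ : 0 < δ) (hα : 0 < α) (n : ℕ) (hn : 1 ≤ n) :
    wn n σ δ α ^ α = (δ / σ) ^ α / (n : ℝ) ^ (1 - α / 2) := by
  have hn0 : (0:ℝ) < n := by exact_mod_cast hn
  unfold wn
  rw [mul_div_assoc, Real.mul_rpow (by positivity) (by positivity), ← Real.rpow_mul hn0.le]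
  have e : (1 / 2 - 1 / α) * α = -(1 - α / 2) := by field_simp; ring
  rw [e, Real.rpow_neg hn0.le]
  field_simp

lemma psi_aux {α : ℝ} (hα : α ∈ Set.Ioo (0 : ℝ) 2) (ψ : ℝ → ℕ → ℝ → ℝ) (hψ : IsPsiFamily ψ) :
    ∃ A > (0:ℝ), ∀ y : ℝ, 1 ≤ |y| → |y| ^ (-(α + 1)) ≤ A * ψ α 0 y ∧
      |ψ α 0 y - |y| ^ (-(α + 1))| ≤ A * ψ α 0 y * (1 / Real.sqrt |y|) ∧
      |ψ α 1 y - Real.log |y| * |y| ^ (-(α + 1))| ≤ A * ψ α 0 y * (1 / Real.sqrt |y|) := by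
  obtain ⟨c0, hc0, C0, h0⟩ := hψ.unifBound {α} (by simpa using hα) isCompact_singleton 0
  obtain ⟨c1, hc1, C1, h1⟩ := hψ.unifBound {α} (by simpa using hα) isCompact_singleton 1
  refine ⟨1 + 2 * (|C0| + |C1| + 4) / c0, by positivity, fun y hy => ?_⟩
  have hy0 : 0 < |y| := by linarith
  set A := 1 + 2 * (|C0| + |C1| + 4) / c0 with hA
  have hA1 : 1 ≤ A := by rw [hA]; have : 0 ≤ 2 * (|C0| + |C1| + 4) / c0 := by positivity
                         linarith
  have hp0 := hψ.pos α hα 0 y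
  have hs : 0 < Real.sqrt |y| := Real.sqrt_pos.mpr hy0
  by_cases h3 : 3 ≤ |y|
  · have e0 := hψ.eq_tail α hα 0 y h3
    have e1 := hψ.eq_tail α hα 1 y h3
    rw [pow_zero, one_div, ← Real.rpow_neg hy0.le] at e0
    rw [pow_one, div_eq_mul_inv, ← Real.rpow_neg hy0.le] at e1
    have hb : 0 ≤ A * ψ α 0 y * (1 / Real.sqrt |y|) := by positivity
    refine ⟨?_, ?_, ?_⟩
    · rw [← e0]; nlinarith
    · rw [← e0, sub_self, abs_zero]; exact hb
    · rw [← e1, sub_self, abs_zero]; exact hb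
  · have h3 : |y| ≤ 3 := (not_le.mp h3).le
    obtain ⟨a0, b0⟩ := h0 α rfl y hy h3
    obtain ⟨a1, b1⟩ := h1 α rfl y hy h3
    have hp1 := hψ.pos α hα 1 y
    have hP0 : 0 < |y| ^ (-(α + 1)) := by positivity
    have hP1 : |y| ^ (-(α + 1)) ≤ 1 :=
      Real.rpow_le_one_of_one_le_of_nonpos hy (by linarith [hα.1])
    have hl0 : 0 ≤ Real.log |y| := Real.log_nonneg hy
    have hl1 : Real.log |y| ≤ 3 := (Real.log_le_self hy0.le).trans h3
    have hsq : 1 / 2 ≤ 1 / Real.sqrt |y| := by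
      apply one_div_le_one_div_of_le hs
      rw [Real.sqrt_le_left (by norm_num)]; linarith
    have hAc : 2 * (|C0| + |C1| + 4) ≤ A * ψ α 0 y := by
      have e : 2 * (|C0| + |C1| + 4) / c0 * c0 = 2 * (|C0| + |C1| + 4) := by field_simp
      have : 2 * (|C0| + |C1| + 4) / c0 * c0 ≤ A * ψ α 0 y := by
        apply mul_le_mul _ a0 hc0.le (by linarith)
        rw [hA]; linarith
      linarith
    have hA2 : |C0| + |C1| + 4 ≤ A * ψ α 0 y * (1 / Real.sqrt |y|) := by
      have : 0 ≤ A * ψ α 0 y := by positivity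
      nlinarith
    have := abs_nonneg C0
    have := abs_nonneg C1
    have := le_abs_self C0
    have := le_abs_self C1
    have hm : Real.log |y| * |y| ^ (-(α + 1)) ≤ 3 * 1 := mul_le_mul hl1 hP1 hP0.le (by norm_num)
    have hm0 : 0 ≤ Real.log |y| * |y| ^ (-(α + 1)) := by positivity
    refine ⟨by linarith, ?_, ?_⟩
    · rw [abs_le]; constructor <;> linarith
    · rw [abs_le]; constructor <;> linarith

lemma final_alg {W L d c dc H K P0 l p0 p1 C A r R G q N1 : ℝ} (hW : 0 < W) (hL : 1 ≤ L) (hC : 0 < C) (hA : 0 < A)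
    (hp0 : 0 < p0) (hp1 : 0 < p1) (hr : 0 ≤ r) (hrR : L * r ≤ R) (hG : 0 ≤ G) (hq : 0 < q)
    (hN1 : L * W ≤ q * N1) (hN : 0 ≤ N1)
    (h0 : |H + c * P0| ≤ C * P0 * (r + W)) (h1 : |K + (dc - c * l) * P0| ≤ C * P0 * (r + W))
    (a0 : P0 ≤ A * p0) (a1 : |p0 - P0| ≤ A * p0 * r) (a2 : |p1 - l * P0| ≤ A * p0 * r) :
    |-W * ((L / 2 + d) * H + K) + c * W * p1 - c / 2 * L * W * p0 - W * (c * d + dc) * p0| ≤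
      (((2 + |d|) * C * A + (2 * |c| + |c * d + dc|) * A) * (1 + q)) * W * (p0 + p1 / L) * (R + G + N1) := by
  have hL0 : 0 < L := by linarith
  set E := A * p0 with hE
  have hE0 : 0 < E := by positivity
  have hrW : 0 ≤ r + W := by linarith
  have h0' : |H + c * P0| ≤ C * E * (r + W) := h0.trans (by gcongr)
  have h1' : |K + (dc - c * l) * P0| ≤ C * E * (r + W) := h1.trans (by gcongr)
  have e : -W * ((L / 2 + d) * H + K) + c * W * p1 - c / 2 * L * W * p0 - W * (c * d + dc) * p0
      = W * (-((L / 2 + d) * (H + c * P0)) + -(K + (dc - c * l) * P0) + c * (p1 - l * P0)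
        + -((c / 2 * L + (c * d + dc)) * (p0 - P0))) := by ring
  have t1 : |L / 2 + d| ≤ L / 2 + |d| := by
    have := abs_add_le (L / 2) d
    rwa [abs_of_pos (by positivity : 0 < L / 2)] at this
  have t2 : |c / 2 * L + (c * d + dc)| ≤ |c| / 2 * L + |c * d + dc| := by
    have := abs_add_le (c / 2 * L) (c * d + dc)
    rwa [abs_mul, abs_div, abs_of_pos hL0, abs_of_pos (by norm_num : (0:ℝ) < 2)] at this
  have b1 : |-((L / 2 + d) * (H + c * P0))| ≤ (L / 2 + |d|) * (C * E * (r + W)) := by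
    rw [abs_neg, abs_mul]; gcongr
  have b2 : |-(K + (dc - c * l) * P0)| ≤ C * E * (r + W) := by rw [abs_neg]; exact h1'
  have b3 : |c * (p1 - l * P0)| ≤ |c| * (E * r) := by rw [abs_mul]; gcongr
  have b4 : |-((c / 2 * L + (c * d + dc)) * (p0 - P0))| ≤ (|c| / 2 * L + |c * d + dc|) * (E * r) := by
    rw [abs_neg, abs_mul]; gcongr
  rw [e, abs_mul, abs_of_pos hW]
  set S1 := -((L / 2 + d) * (H + c * P0))
  set S2 := -(K + (dc - c * l) * P0)
  set S3 := c * (p1 - l * P0)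
  set S4 := -((c / 2 * L + (c * d + dc)) * (p0 - P0))
  have hsum : |S1 + S2 + S3 + S4| ≤ (L / 2 + |d|) * (C * E * (r + W)) + C * E * (r + W) + |c| * (E * r)
      + (|c| / 2 * L + |c * d + dc|) * (E * r) := by
    have i1 := abs_add_le (S1 + S2 + S3) S4
    have i2 := abs_add_le (S1 + S2) S3
    have i3 := abs_add_le S1 S2
    linarith
  set m := |c * d + dc| with hm
  have hm0 : 0 ≤ m := abs_nonneg _
  have hd0 := abs_nonneg d
  have hc0 := abs_nonneg c
  have s1 : (L / 2 + |d|) + 1 ≤ (2 + |d|) * L := by nlinarith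
  have s2 : |c| + (|c| / 2 * L + m) ≤ (2 * |c| + m) * L := by nlinarith
  have hR0 : 0 ≤ R := le_trans (by positivity) hrR
  have hX : 0 ≤ L * (r + W) := by positivity
  have g1 : 0 ≤ q * R := mul_nonneg hq.le hR0
  have g2 : 0 ≤ q * G := mul_nonneg hq.le hG
  have g3 : 0 ≤ L * W := mul_nonneg hL0.le hW.le
  have g4 : 0 ≤ q * N1 := mul_nonneg hq.le hN
  have hY1 : (1 + q) * (R + G + N1) = R + G + N1 + q * R + q * G + q * N1 := by ring
  have hb : L * (r + W) ≤ (1 + q) * (R + G + N1) := by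
    rw [hY1, mul_add]; linarith
  have hb2 : L * r ≤ (1 + q) * (R + G + N1) := by
    rw [hY1]; linarith
  have hY : 0 ≤ (1 + q) * (R + G + N1) := le_trans hX hb
  have f1 : |S1 + S2 + S3 + S4| ≤ ((2 + |d|) * C * A + (2 * |c| + m) * A) * p0 * ((1 + q) * (R + G + N1)) := by
    calc _ ≤ _ := hsum
      _ = ((L / 2 + |d|) + 1) * (C * E * (r + W)) + (|c| + (|c| / 2 * L + m)) * (E * r) := by ring
      _ ≤ ((2 + |d|) * L) * (C * E * (r + W)) + ((2 * |c| + m) * L) * (E * r) := by gcongr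
      _ = (2 + |d|) * C * E * (L * (r + W)) + (2 * |c| + m) * E * (L * r) := by ring
      _ ≤ (2 + |d|) * C * E * ((1 + q) * (R + G + N1)) + (2 * |c| + m) * E * ((1 + q) * (R + G + N1)) := by gcongr
      _ = _ := by rw [hE]; ring
  have hpp : p0 ≤ p0 + p1 / L := by have : 0 < p1 / L := by positivity
                                    linarith
  calc W * |S1 + S2 + S3 + S4| ≤ W * (((2 + |d|) * C * A + (2 * |c| + m) * A) * (p0 + p1 / L) * ((1 + q) * (R + G + N1))) := by
        gcongr
        refine f1.trans ?_
        gcongr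
    _ = _ := by ring

/-- sharp approximation of `l_α` for `|y| > Γ`. -/
theorem statement10 (σ δ α : ℝ) (hσ : 0 < σ) (hδ : 0 < δ) (hα : α ∈ Set.Ioo (0 : ℝ) 2)
    (ψ : ℝ → ℕ → ℝ → ℝ) (hψ : IsPsiFamily ψ) :
    ∃ C > (0 : ℝ), ∃ N : ℕ, ∀ n ≥ N, ∀ Γ : ℝ, 1 ≤ Γ → ∀ y : ℝ, Γ < |y| →
      |lFun n α y (wn n σ δ α) + cAlpha α * wn n σ δ α ^ α * ψ α 1 y
          - cAlpha α / 2 * Real.log (Real.log n) * wn n σ δ α ^ α * ψ α 0 y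
          - wn n σ δ α ^ α * (cAlpha α * Real.log (δ / σ) + deriv cAlpha α) * ψ α 0 y| ≤
        C * wn n σ δ α ^ α * (ψ α 0 y + ψ α 1 y / Real.log (Real.log n)) *
          (Real.log (Real.log n) / Real.sqrt Γ + Real.log n * gauss (Γ / 3)
            + Real.log n / (n : ℝ) ^ (1 - α / 2)) := by
  obtain ⟨C, hC, hHK⟩ := HK_asymp hα
  obtain ⟨A, hA, hP⟩ := psi_aux hα ψ hψ
  have hlim : Tendsto (fun n : ℕ => Real.log (Real.log n)) atTop atTop :=
    Real.tendsto_log_atTop.comp (Real.tendsto_log_atTop.comp tendsto_natCast_atTop_atTop)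
  obtain ⟨N, hN⟩ := eventually_atTop.mp ((hlim.eventually_ge_atTop 1).and (eventually_ge_atTop 1))
  have hq : 0 < (δ / σ) ^ α := by positivity
  refine ⟨((2 + |Real.log (δ / σ)|) * C * A + (2 * |cAlpha α| + |cAlpha α * Real.log (δ / σ) + deriv cAlpha α|) * A)
    * (1 + (δ / σ) ^ α), by positivity, N, fun n hn Γ hΓ y hy => ?_⟩
  obtain ⟨hL, hn1⟩ := hN n hn
  have hn0 : (1:ℝ) ≤ n := by exact_mod_cast hn1
  have hlog : 0 ≤ Real.log n := Real.log_nonneg hn0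
  have hy1 : 1 ≤ |y| := by linarith
  have hw : 0 < wn n σ δ α := by unfold wn; positivity
  have hW : 0 < wn n σ δ α ^ α := by positivity
  obtain ⟨h0, h1⟩ := hHK y (wn n σ δ α ^ α) hy1 hW.le
  obtain ⟨a0, a1, a2⟩ := hP y hy1
  rw [lFun_eq hσ hδ hα.1 n hn1]
  have hLl := Real.log_le_self hlog
  refine final_alg hW hL hC hA (hψ.pos α hα 0 y) (hψ.pos α hα 1 y) (by positivity) ?_ ?_ hq ?_ ?_ h0 h1 a0 a1 a2
  · rw [mul_one_div]
    gcongr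
  · unfold gauss; positivity
  · rw [wn_pow hσ hδ hα.1 n hn1, mul_div_assoc', mul_div_assoc', mul_comm]
    gcongr
  · positivity

end LevyLAN
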